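/- arXiv:2409.03310 — 2 statements merged into one kernel-verified Lean document; each statement's English description precedes it below -/
import Mathlib

section
/- Let (X,f) be a uniquely ergodic minimal dynamical system on a non-degenerate connected compact metric space X. If (X,f) is either not totally uniquely ergodic, or is totally uniquely ergodic but not topologically weakly mixing, then there exist m ≥ 2 and a non-uniform A ∈ C(X, GL(m,ℝ)). -/
open MeasureTheory Filter Topology Set
open scoped ENNReal NNReal

attribute [local instance] Matrix.normedAddCommGroup

noncomputable section

/-- The cocycle `A(n,x) = A(f^{n-1}x) ⋯ A(fx) A(x)` generated by a matrix-valued map `A`. -/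
def cocycle {X : Type*} {m : ℕ} (f : X → X) (A : X → Matrix (Fin m) (Fin m) ℝ) :
    ℕ → X → Matrix (Fin m) (Fin m) ℝ
  | 0, _ => 1
  | n + 1, x => A (f^[n] x) * cocycle f A n x

/-- `A` is a uniform cocycle over `f` if `(1/n) log ‖A(n,x)‖` converges uniformly on `X`. -/
def IsUniformCocycle {X : Type*} [TopologicalSpace X] {m : ℕ} (f : X → X)
    (A : X → Matrix (Fin m) (Fin m) ℝ) : Prop :=
  ∃ L : X → ℝ, TendstoUniformly (fun (n : ℕ) (x : X) => Real.log ‖cocycle f A n x‖ / n) L atTop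

/-- `A` is a continuous map from `X` to `GL(m,ℝ)`. -/
def ContGL {X : Type*} [TopologicalSpace X] {m : ℕ} (A : X → Matrix (Fin m) (Fin m) ℝ) : Prop :=
  Continuous A ∧ ∀ x, IsUnit (A x)

/-- `μ` is an `f`-invariant Borel probability measure. -/
def InvProb {X : Type*} [MeasurableSpace X] (f : X → X) (μ : Measure X) : Prop :=
  IsProbabilityMeasure μ ∧ μ.map f = μ

/-- `f` is uniquely ergodic: it has exactly one invariant Borel probability measure. -/
def UniquelyErgodic {X : Type*} [MeasurableSpace X] (f : X → X) : Prop :=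
  ∃! μ : Measure X, InvProb f μ

/-- `f` is uniquely ergodic with unique invariant Borel probability measure `μ`. -/
def UniquelyErgodicWith {X : Type*} [MeasurableSpace X] (f : X → X) (μ : Measure X) : Prop :=
  InvProb f μ ∧ ∀ ν : Measure X, InvProb f ν → ν = μ

/-- `f` is totally uniquely ergodic: every positive power of `f` is uniquely ergodic. -/
def TotallyUniquelyErgodic {X : Type*} [MeasurableSpace X] (f : X → X) : Prop :=
  ∀ n : ℕ, 0 < n → UniquelyErgodic (f^[n])

/-- Topological transitivity. -/
def TopTransitive {X : Type*} [TopologicalSpace X] (f : X → X) : Prop :=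
  ∀ U V : Set X, IsOpen U → IsOpen V → U.Nonempty → V.Nonempty →
    ∃ k : ℕ, 0 < k ∧ (f^[k] '' U ∩ V).Nonempty

/-- Total transitivity: every positive power is topologically transitive. -/
def TotallyTransitive {X : Type*} [TopologicalSpace X] (f : X → X) : Prop :=
  ∀ n : ℕ, 0 < n → TopTransitive (f^[n])

/-- Topological weak mixing: `f × f` is topologically transitive. -/
def TopWeaklyMixing {X : Type*} [TopologicalSpace X] (f : X → X) : Prop :=
  TopTransitive (Prod.map f f)

/-- Topological mixing. -/
def TopMixing {X : Type*} [TopologicalSpace X] (f : X → X) : Prop :=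
  ∀ U V : Set X, IsOpen U → IsOpen V → U.Nonempty → V.Nonempty →
    ∃ N : ℕ, 0 < N ∧ ∀ k ≥ N, (f^[k] '' U ∩ V).Nonempty

/-- Minimality: every forward orbit is dense. -/
def MinimalSys {X : Type*} [TopologicalSpace X] (f : X → X) : Prop :=
  ∀ x : X, Dense (Set.range fun n : ℕ => f^[n] x)


/-- Over a minimal system, a continuous invariant function is constant. -/
lemma MinimalSys.eq_of_invariant {X Y : Type*} [TopologicalSpace X] [TopologicalSpace Y] [T2Space Y]
    {f : X → X} (hmin : MinimalSys f) {g : X → Y} (hg : Continuous g)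
    (hinv : ∀ x, g (f x) = g x) (x y : X) : g x = g y := by
  have hit : ∀ n : ℕ, g (f^[n] x) = g x := by
    intro n
    induction n with
    | zero => rfl
    | succ n ih => rw [Function.iterate_succ_apply', hinv, ih]
  have : g = fun _ => g x := by
    refine Continuous.ext_on (hmin x) hg continuous_const ?_
    rintro _ ⟨n, rfl⟩
    exact hit n
  exact (congrFun this y).symm

lemma MinimalSys.exists_iterate_mem {X : Type*} [TopologicalSpace X] {f : X → X}
    (hmin : MinimalSys f) {U : Set X} (hU : IsOpen U) (hne : U.Nonempty) (x : X) :
    ∃ n : ℕ, f^[n] x ∈ U := by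
  obtain ⟨_, ⟨n, rfl⟩, hy⟩ := (hmin x).exists_mem_open hU hne
  exact ⟨n, hy⟩

/-- An invariant probability measure of a minimal system has full support. -/
lemma MinimalSys.isOpenPosMeasure {X : Type*} [TopologicalSpace X] [MeasurableSpace X]
    [BorelSpace X] {f : X → X} (hmin : MinimalSys f) {μ : Measure X} [IsProbabilityMeasure μ]
    (hμ : MeasurePreserving f μ μ) : μ.IsOpenPosMeasure := by
  refine ⟨fun U hU hne h0 => ?_⟩
  have hcov : (univ : Set X) ⊆ ⋃ n : ℕ, f^[n] ⁻¹' U := fun x _ => by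
    obtain ⟨n, hn⟩ := hmin.exists_iterate_mem hU hne x
    exact mem_iUnion.2 ⟨n, hn⟩
  have : μ univ = 0 := measure_mono_null hcov <| measure_iUnion_null fun n => by
    rw [(hμ.iterate n).measure_preimage hU.measurableSet.nullMeasurableSet, h0]
  simp at this

/-- The unique invariant measure is ergodic. -/
lemma UniquelyErgodicWith.ergodic {X : Type*} [MeasurableSpace X] {f : X → X} {μ : Measure X}
    (hfm : Measurable f) (h : UniquelyErgodicWith f μ) : Ergodic f μ := by
  apply Ergodic.of_mem_extremePoints
  refine ⟨⟨⟨hfm, h.1.2⟩, h.1.1⟩, ?_⟩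
  rintro ν₁ ⟨h₁, h₁'⟩ ν₂ ⟨h₂, h₂'⟩ -
  exact h.2 ν₁ ⟨h₁', h₁.map_eq⟩
lemma integrable_of_continuous {X E : Type*} [MetricSpace X] [CompactSpace X]
    [MeasurableSpace X] [BorelSpace X] [NormedAddCommGroup E] (μ : Measure X) [IsFiniteMeasure μ]
    {g : X → E} (hg : Continuous g) : Integrable g μ :=
  hg.integrable_of_hasCompactSupport (HasCompactSupport.of_compactSpace g)

lemma integral_comp_of_measurePreserving {X E : Type*} [MetricSpace X] [CompactSpace X]
    [MeasurableSpace X] [BorelSpace X] [NormedAddCommGroup E] [NormedSpace ℝ E] {μ : Measure X}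
    [IsFiniteMeasure μ] {f : X → X} (hf : MeasurePreserving f μ μ) {g : X → E}
    (hg : Continuous g) : ∫ x, g (f x) ∂μ = ∫ x, g x ∂μ := by
  conv_rhs => rw [← hf.map_eq]
  rw [integral_map hf.measurable.aemeasurable]
  rw [hf.map_eq]
  exact (integrable_of_continuous μ hg).aestronglyMeasurable

/-- A mean-zero nonvanishing equivariant continuous map to a Hilbert space on which the dynamics
acts by an isometry produces a nonconstant continuous eigenfunction: its covariance operator is
compact, self-adjoint, and commutes with the isometry. -/
lemma exists_eigenfunction_of_mean_zero {X H : Type*} [MetricSpace X] [CompactSpace X]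
    [MeasurableSpace X] [BorelSpace X] [NormedAddCommGroup H] [InnerProductSpace ℂ H]
    [CompleteSpace H] {μ : Measure X} [IsProbabilityMeasure μ] [μ.IsOpenPosMeasure] {f : X → X}
    (hf : MeasurePreserving f μ μ) (U : H →ₗᵢ[ℂ] H) {Ψ : X → H}
    (hΨ : Continuous Ψ) (hU : ∀ x, U (Ψ (f x)) = Ψ x) (hmean : ∫ x, Ψ x ∂μ = 0)
    {x₀ : X} (hx₀ : Ψ x₀ ≠ 0) :
    ∃ g : X → ℂ, Continuous g ∧ (∃ c : ℂ, ‖c‖ = 1 ∧ ∀ x, g (f x) = c * g x) ∧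
      ∃ x y, g x ≠ g y := by
  set R : X → H →L[ℂ] H := fun x => InnerProductSpace.rankOne ℂ (Ψ x) (Ψ x) with hR
  have hRc : Continuous R := by
    exact (ContinuousLinearMap.smulRightL ℂ H H).continuous₂.comp
      (((innerSL ℂ).continuous.comp hΨ).prodMk hΨ)
  have hRi : Integrable R μ := integrable_of_continuous μ hRc
  set C : H →L[ℂ] H := ∫ x, R x ∂μ with hC
  have hCapp : ∀ v, C v = ∫ x, inner ℂ (Ψ x) v • Ψ x ∂μ := by
    intro v
    rw [hC, ContinuousLinearMap.integral_apply hRi]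
    simp [hR]
  have hcont : ∀ v, Continuous fun x => inner ℂ (Ψ x) v • Ψ x := fun v =>
    (hΨ.inner continuous_const).smul hΨ
  have hCinner : ∀ u v, inner ℂ u (C v) = ∫ x, inner ℂ (Ψ x) v * inner ℂ u (Ψ x) ∂μ := by
    intro u v
    rw [hCapp, ← integral_inner (integrable_of_continuous μ (hcont v))]
    simp [inner_smul_right]
  have hcompact : IsCompactOperator C := by
    have hconv : Convex ℝ {T : H →L[ℂ] H | IsCompactOperator T} := by
      have := ((compactOperator (RingHom.id ℂ) H H).restrictScalars ℝ).convex
      exact this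
    refine hconv.integral_mem isClosed_setOfPred_isCompactOperator (ae_of_all _ fun x => ?_) hRi
    change IsCompactOperator (R x)
    have : IsCompactOperator (ContinuousLinearMap.toSpanSingleton ℂ (Ψ x)) :=
      isCompactOperator_of_locallyCompactSpace_rng _
    exact this.comp_clm (innerSL ℂ (Ψ x))
  have hsymm : (C : H →ₗ[ℂ] H).IsSymmetric := by
    intro u v
    change inner ℂ (C u) v = inner ℂ u (C v)
    rw [← inner_conj_symm, hCinner, hCinner, ← integral_conj]
    refine integral_congr_ae (ae_of_all _ fun x => ?_)
    simp [mul_comm]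
  have hne : C ≠ 0 := by
    intro h0
    have h1 := hCinner (Ψ x₀) (Ψ x₀)
    have h2 : ∀ x, inner ℂ (Ψ x) (Ψ x₀) * inner ℂ (Ψ x₀) (Ψ x) =
        ((‖inner ℂ (Ψ x) (Ψ x₀)‖ ^ 2 : ℝ) : ℂ) := by
      intro x
      rw [← inner_conj_symm (Ψ x₀) (Ψ x), Complex.mul_conj, Complex.normSq_eq_norm_sq]
    simp only [h0, h2, zero_apply, inner_zero_right, integral_complex_ofReal] at h1
    have hpos : 0 < ∫ x, ‖inner ℂ (Ψ x) (Ψ x₀)‖ ^ 2 ∂μ := by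
      refine Continuous.integral_pos_of_hasCompactSupport_nonneg_nonzero (x := x₀)
        ((hΨ.inner continuous_const).norm.pow 2) (HasCompactSupport.of_compactSpace _)
        (fun x => by positivity) ?_
      simpa using hx₀
    exact hpos.ne (by exact_mod_cast h1)
  obtain ⟨ρ, hρ, hρ0⟩ : ∃ ρ : ℂ, Module.End.HasEigenvalue (C : H →ₗ[ℂ] H) ρ ∧ ρ ≠ 0 := by
    by_contra! hcon
    exact hne ((ContinuousLinearMap.eq_zero_of_forall_hasEigenvalue_eq_zero hcompact hsymm).1 hcon)
  have hUC : ∀ v, U (C v) = C (U v) := by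
    intro v
    rw [hCapp, hCapp]
    have h1 := U.toContinuousLinearMap.integral_comp_comm (integrable_of_continuous μ (hcont v))
    rw [LinearIsometry.coe_toContinuousLinearMap] at h1
    rw [← h1, ← integral_comp_of_measurePreserving hf
      (g := fun x => U (inner ℂ (Ψ x) v • Ψ x)) (U.continuous.comp (hcont v))]
    refine integral_congr_ae (ae_of_all _ fun x => ?_)
    simp only [map_smul]
    rw [hU, ← U.inner_map_map, hU]
  set E := Module.End.eigenspace (C : H →ₗ[ℂ] H) ρ with hE
  have : FiniteDimensional ℂ E := ContinuousLinearMap.finite_dimensional_eigenspace hcompact ρ hρ0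
  have : Nontrivial E := Submodule.nontrivial_iff_ne_bot.2 hρ
  have hUE : ∀ v ∈ E, U.toLinearMap v ∈ E := by
    intro v hv
    rw [hE, Module.End.mem_eigenspace_iff] at hv ⊢
    change C (U v) = _
    rw [← hUC]
    change U ((C : H →ₗ[ℂ] H) v) = _
    rw [hv]
    simp
  obtain ⟨c, hc⟩ := Module.End.exists_eigenvalue (U.toLinearMap.restrict hUE)
  obtain ⟨⟨w, hwE⟩, hw⟩ := hc.exists_hasEigenvector
  have hw0 : w ≠ 0 := fun h => hw.2 (by simpa using h)
  have hUw : U w = c • w := congrArg Subtype.val hw.apply_eq_smul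
  have hcn : ‖c‖ = 1 := by
    have := U.norm_map w
    rw [hUw, norm_smul] at this
    exact mul_right_cancel₀ (norm_ne_zero_iff.2 hw0) (by rw [this, one_mul])
  refine ⟨fun x => inner ℂ w (Ψ x), continuous_const.inner hΨ,
    ⟨starRingEnd ℂ c, by simpa using hcn, fun x => ?_⟩, ?_⟩
  · beta_reduce
    rw [← U.inner_map_map, hU, hUw, inner_smul_left]
  · by_contra! hcon
    have h1 : ∀ x, inner ℂ w (Ψ x) = 0 := by
      intro x
      have h2 := integral_inner (𝕜 := ℂ) (integrable_of_continuous μ hΨ) w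
      rw [hmean, inner_zero_right, integral_congr_ae (ae_of_all _ fun y => hcon y x)] at h2
      simpa using h2
    have h3 : C w = 0 := by
      rw [hCapp]
      have : ∀ x, inner ℂ (Ψ x) w = 0 := fun x => inner_eq_zero_symm.1 (h1 x)
      simp [this]
    have h4 : C w = ρ • w := Module.End.mem_eigenspace_iff.1 hwE
    rw [h3] at h4
    exact (smul_ne_zero hρ0 hw0) h4.symm

/-- The mean of an equivariant map to a Hilbert space is a fixed vector; subtracting it reduces
to the mean-zero case. -/
lemma exists_eigenfunction_of_equivariant {X H : Type*} [MetricSpace X] [CompactSpace X]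
    [MeasurableSpace X] [BorelSpace X] [NormedAddCommGroup H] [InnerProductSpace ℂ H]
    [CompleteSpace H] {μ : Measure X} [IsProbabilityMeasure μ] [μ.IsOpenPosMeasure] {f : X → X}
    (hf : MeasurePreserving f μ μ) (U : H →ₗᵢ[ℂ] H) {Φ : X → H}
    (hΦ : Continuous Φ) (hU : ∀ x, U (Φ (f x)) = Φ x) (hne : ∃ x y, Φ x ≠ Φ y) :
    ∃ g : X → ℂ, Continuous g ∧ (∃ c : ℂ, ‖c‖ = 1 ∧ ∀ x, g (f x) = c * g x) ∧
      ∃ x y, g x ≠ g y := by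
  set v := ∫ x, Φ x ∂μ with hv
  have hΦi := integrable_of_continuous μ hΦ
  have hUv : U v = v := by
    have h1 := U.toContinuousLinearMap.integral_comp_comm hΦi
    rw [LinearIsometry.coe_toContinuousLinearMap] at h1
    rw [hv, ← h1, ← integral_comp_of_measurePreserving hf (g := fun x => U (Φ x))
      (U.continuous.comp hΦ)]
    exact integral_congr_ae (ae_of_all _ fun x => hU x)
  obtain ⟨x₀, hx₀⟩ : ∃ x, Φ x - v ≠ 0 := by
    obtain ⟨x, y, hxy⟩ := hne
    by_contra! hcon
    exact hxy ((sub_eq_zero.1 (hcon x)).trans (sub_eq_zero.1 (hcon y)).symm)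
  refine exists_eigenfunction_of_mean_zero hf U (Ψ := fun x => Φ x - v) (by fun_prop)
    (fun x => ?_) ?_ hx₀
  · rw [map_sub, hU, hUv]
  · rw [integral_sub hΦi (integrable_const v)]
    simp [hv]

/-- A homeomorphism preserving a measure of full support that is not transitive has a nontrivial
open invariant set. -/
lemma exists_isOpen_invariant_of_not_topTransitive {Y : Type*} [TopologicalSpace Y]
    [MeasurableSpace Y] [BorelSpace Y] {T : Y → Y} (hT : IsHomeomorph T) {μ : Measure Y}
    [IsFiniteMeasure μ] [μ.IsOpenPosMeasure] (hμ : MeasurePreserving T μ μ)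
    (hnt : ¬ TopTransitive T) :
    ∃ W V : Set Y, IsOpen W ∧ IsOpen V ∧ W.Nonempty ∧ V.Nonempty ∧ Disjoint W V ∧
      ∀ p, T p ∈ W ↔ p ∈ W := by
  simp only [TopTransitive, not_forall, not_exists, not_and] at hnt
  obtain ⟨U, V, hU, hV, hUne, hVne, hUV⟩ := hnt
  have hopen : ∀ j, IsOpenMap T^[j] := fun j => by
    induction j with
    | zero => exact IsOpenMap.id
    | succ j ih => exact ih.comp hT.isOpenMap
  have hcont : ∀ j, Continuous T^[j] := fun j => hT.continuous.iterate j
  refine ⟨⋃ j : ℕ, ⋃ k : ℕ, T^[k] ⁻¹' (T^[j] '' U), V, ?_, hV, ?_, hVne, ?_, ?_⟩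
  · exact isOpen_iUnion fun j => isOpen_iUnion fun k => (hopen j _ hU).preimage (hcont k)
  · obtain ⟨u, hu⟩ := hUne
    exact ⟨u, mem_iUnion₂.2 ⟨0, 0, u, hu, rfl⟩⟩
  · rw [Set.disjoint_left]
    intro p hp hpV
    obtain ⟨j, k, q, hq, hqp⟩ := mem_iUnion₂.1 hp
    rcases lt_or_ge k j with hkj | hjk
    · obtain ⟨i, rfl⟩ := Nat.exists_eq_add_of_lt hkj
      have : T^[i + 1] q = p := by
        apply hT.injective.iterate k
        rw [← hqp, ← Function.iterate_add_apply, add_assoc]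
      exact hUV (i + 1) i.succ_pos ⟨p, ⟨q, hq, this⟩, hpV⟩
    · obtain ⟨i, rfl⟩ := Nat.exists_eq_add_of_le hjk
      have hiq : q = T^[i] p := by
        apply hT.injective.iterate j
        rw [hqp, ← Function.iterate_add_apply]
      set O := V ∩ T^[i] ⁻¹' U with hO
      have hOo : IsOpen O := hV.inter (hU.preimage (hcont i))
      have hpO : p ∈ O := ⟨hpV, show T^[i] p ∈ U from hiq ▸ hq⟩
      obtain ⟨m, hm, hne⟩ := hμ.conservative.exists_gt_measure_inter_ne_zero
        hOo.measurableSet.nullMeasurableSet (hOo.measure_ne_zero μ ⟨p, hpO⟩) i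
      obtain ⟨r, hr, hr'⟩ := nonempty_of_measure_ne_zero hne
      obtain ⟨l, rfl⟩ := Nat.exists_eq_add_of_lt hm
      refine hUV (l + 1) l.succ_pos ⟨T^[l + 1] (T^[i] r), ⟨_, hr.2, rfl⟩, ?_⟩
      rw [← Function.iterate_add_apply]
      have : l + 1 + i = i + l + 1 := by ring
      rw [this]
      exact hr'.1
  · intro p
    simp only [mem_iUnion, mem_preimage]
    constructor
    · rintro ⟨j, k, h⟩
      exact ⟨j, k + 1, h⟩
    · rintro ⟨j, k, q, hq, h⟩
      refine ⟨j + 1, k, q, hq, ?_⟩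
      rw [Function.iterate_succ_apply', h, ← Function.iterate_succ_apply' T k p,
        Function.iterate_succ_apply]

/-- For an open invariant set of `f × f` with `f` minimal, the slices vary continuously in
measure. -/
lemma tendsto_measure_symmDiff_slice {X : Type*} [MetricSpace X] [MeasurableSpace X]
    [BorelSpace X] {f : X → X} (hmin : MinimalSys f) {μ : Measure X} [IsProbabilityMeasure μ]
    (hμ : MeasurePreserving f μ μ) {W : Set (X × X)} (hW : IsOpen W)
    (hinv : ∀ p, Prod.map f f p ∈ W ↔ p ∈ W) (x : X) :
    Tendsto (fun z => μ (symmDiff (Prod.mk z ⁻¹' W) (Prod.mk x ⁻¹' W))) (𝓝 x) (𝓝 0) := by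
  set S : X → Set X := fun z => Prod.mk z ⁻¹' W with hS
  have hSo : ∀ z, IsOpen (S z) := fun z => hW.preimage (by fun_prop)
  have hSm : ∀ z, MeasurableSet (S z) := fun z => (hSo z).measurableSet
  have hSf : ∀ z, f ⁻¹' S (f z) = S z := fun z => by
    ext y
    exact hinv (z, y)
  have hμS : ∀ z, μ (S (f z)) = μ (S z) := fun z => by
    rw [← hSf z, hμ.measure_preimage (hSm _).nullMeasurableSet]
  have hlow : ∀ x, Tendsto (fun z => μ (S x \ S z)) (𝓝 x) (𝓝 0) := fun x => by
    rw [← measure_empty (μ := μ)]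
    refine tendsto_measure_of_tendsto_indicator_of_isFiniteMeasure _ μ
      (fun z => (hSm x).diff (hSm z)) fun y => ?_
    by_cases hy : y ∈ S x
    · have : ∀ᶠ z in 𝓝 x, y ∈ S z :=
        (hW.preimage (f := fun z => (z, y)) (by fun_prop)).mem_nhds hy
      filter_upwards [this] with z hz
      simp [hz]
    · exact Eventually.of_forall fun z => by simp [hy]
  have hle : ∀ x y, μ (S y) ≤ μ (S x) := fun x y => by
    refine ENNReal.le_of_forall_pos_le_add fun ε hε _ => ?_
    have : ∀ᶠ z in 𝓝 y, μ (S y \ S z) < ε := (hlow y).eventually_lt_const (by simpa using hε)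
    obtain ⟨O, hO, hOo, hyO⟩ := eventually_nhds_iff.1 this
    obtain ⟨n, hn⟩ := hmin.exists_iterate_mem hOo ⟨y, hyO⟩ x
    have hit : ∀ n : ℕ, μ (S (f^[n] x)) = μ (S x) := fun n => by
      induction n with
      | zero => rfl
      | succ n ih => rw [Function.iterate_succ_apply', hμS, ih]
    calc μ (S y) ≤ μ (S (f^[n] x)) + μ (S y \ S (f^[n] x)) := by
          refine (measure_mono ?_).trans (measure_union_le _ _)
          intro w hw
          by_cases h : w ∈ S (f^[n] x)
          · exact Or.inl h
          · exact Or.inr ⟨hw, h⟩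
      _ ≤ μ (S x) + ε := by
          rw [hit]
          gcongr
          exact (hO _ hn).le
  have heq : ∀ z, μ (S z \ S x) = μ (S x \ S z) := fun z =>
    measure_sdiff_symm (hSm z).nullMeasurableSet (hSm x).nullMeasurableSet
      (le_antisymm (hle _ _) (hle _ _)) (measure_ne_top _ _)
  have : ∀ z, μ (symmDiff (S z) (S x)) = μ (S x \ S z) + μ (S x \ S z) := fun z => by
    rw [measure_symmDiff_eq (hSm z).nullMeasurableSet (hSm x).nullMeasurableSet, heq]
  refine (tendsto_congr this).2 ?_
  simpa using (hlow x).add (hlow x)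

/-- A uniquely ergodic minimal homeomorphism which is not topologically weakly mixing has a
nonconstant continuous eigenfunction. -/
lemma exists_eigenfunction_of_not_topWeaklyMixing {X : Type*} [MetricSpace X] [CompactSpace X]
    [MeasurableSpace X] [BorelSpace X] {f : X → X} (hf : IsHomeomorph f) (hmin : MinimalSys f)
    {μ : Measure X} (hμ : UniquelyErgodicWith f μ) (hnw : ¬ TopWeaklyMixing f) :
    ∃ g : X → ℂ, Continuous g ∧ (∃ c : ℂ, ‖c‖ = 1 ∧ ∀ x, g (f x) = c * g x) ∧
      ∃ x y, g x ≠ g y := by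
  have herg := hμ.ergodic hf.continuous.measurable
  have hpres := herg.toMeasurePreserving
  have := hμ.1.1
  have := hmin.isOpenPosMeasure hpres
  obtain ⟨W, V, hW, hV, ⟨⟨u, u'⟩, hu⟩, ⟨⟨v, v'⟩, hv⟩, hdisj, hinv⟩ :=
    exists_isOpen_invariant_of_not_topTransitive (hf.prodMap hf) (hpres.prod hpres) hnw
  have hSo : ∀ z, IsOpen (Prod.mk z ⁻¹' W) := fun z => hW.preimage (by fun_prop)
  have hSm : ∀ z, MeasurableSet (Prod.mk z ⁻¹' W) := fun z => (hSo z).measurableSet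
  refine exists_eigenfunction_of_equivariant hpres
    (Lp.compMeasurePreservingₗᵢ ℂ f hpres : Lp ℂ 2 μ →ₗᵢ[ℂ] Lp ℂ 2 μ)
    (Φ := fun z => indicatorConstLp 2 (hSm z) (measure_ne_top μ _) (1 : ℂ)) ?_ ?_ ?_
  · rw [continuous_iff_continuousAt]
    intro x
    exact tendsto_indicatorConstLp_set (by simp)
      (tendsto_measure_symmDiff_slice hmin hpres hW hinv x)
  · intro x
    change Lp.compMeasurePreserving f hpres _ = _
    rw [Lp.indicatorConstLp_compMeasurePreserving, indicatorConstLp_inj _ _ _ _ one_ne_zero]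
    refine Eq.eventuallyEq ?_
    ext y
    exact hinv (x, y)
  · by_contra! hcon
    have hae : ∀ x y, (Prod.mk x ⁻¹' W : Set X) =ᵐ[μ] (Prod.mk y ⁻¹' W : Set X) := fun x y =>
      (indicatorConstLp_inj _ _ _ _ one_ne_zero).1 (hcon x y)
    have hfix : f ⁻¹' (Prod.mk (f u) ⁻¹' W) =ᵐ[μ] (Prod.mk (f u) ⁻¹' W : Set X) := by
      have : f ⁻¹' (Prod.mk (f u) ⁻¹' W) = Prod.mk u ⁻¹' W := by
        ext y
        exact hinv (u, y)
      rw [this]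
      exact hae _ _
    rcases herg.quasiErgodic.ae_empty_or_univ₀ (hSm _).nullMeasurableSet hfix with h | h
    · exact (hSo u).measure_ne_zero μ ⟨u', hu⟩ (ae_eq_empty.1 ((hae u (f u)).trans h))
    · have h1 : μ (Prod.mk v ⁻¹' W)ᶜ = 0 := ae_eq_univ.1 ((hae v (f u)).trans h)
      have hVo : IsOpen (Prod.mk v ⁻¹' V) := hV.preimage (by fun_prop)
      refine hVo.measure_ne_zero μ ⟨v', hv⟩ (measure_mono_null ?_ h1)
      intro y hy hy'
      exact Set.disjoint_left.1 hdisj hy' hy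

/-- A nonconstant continuous eigenfunction of a minimal homeomorphism of a connected compact space
yields a factor map onto a rotation of the circle. -/
lemma exists_circle_factor {X : Type*} [MetricSpace X] [CompactSpace X] [ConnectedSpace X]
    {f : X → X} (hf : IsHomeomorph f) (hmin : MinimalSys f) {g : X → ℂ} (hg : Continuous g)
    {c : ℂ} (hc : ‖c‖ = 1) (hgc : ∀ x, g (f x) = c * g x) (hne : ∃ x y, g x ≠ g y) :
    ∃ (h : X → Circle) (w : Circle), Continuous h ∧ (∀ x, h (f x) = w * h x) ∧
      Function.Surjective h := by
  have hnorm : ∀ x y, ‖g x‖ = ‖g y‖ := hmin.eq_of_invariant (by fun_prop) fun x => by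
    rw [hgc, norm_mul, hc, one_mul]
  have hg0 : ∀ x, g x ≠ 0 := fun x hx => by
    obtain ⟨y, z, hyz⟩ := hne
    have : ∀ y, g y = 0 := fun y => by rw [← norm_eq_zero, hnorm y x, hx, norm_zero]
    exact hyz ((this y).trans (this z).symm)
  obtain ⟨x₀⟩ : Nonempty X := inferInstance
  have hr : ‖g x₀‖ ≠ 0 := norm_ne_zero_iff.2 (hg0 x₀)
  have hunit : ∀ x, g x / ‖g x₀‖ ∈ Submonoid.unitSphere ℂ := fun x => by
    refine mem_sphere_zero_iff_norm.2 ?_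
    rw [norm_div, Complex.norm_real, norm_norm, hnorm x x₀, div_self hr]
  let h : X → Circle := fun x => ⟨g x / ‖g x₀‖, hunit x⟩
  let w : Circle := ⟨c, mem_sphere_zero_iff_norm.2 hc⟩
  have hh : Continuous h := by
    refine Continuous.subtype_mk ?_ _
    exact hg.div_const _
  have hcoe : ∀ x, (h x : ℂ) = g x / ‖g x₀‖ := fun x => rfl
  have hhw : ∀ x, h (f x) = w * h x := fun x => by
    apply Circle.ext
    rw [Circle.coe_mul, hcoe, hcoe, hgc, mul_div_assoc]
  have hw : ∀ n : ℕ, 0 < n → w ^ n ≠ 1 := fun n hn hwn => by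
    have hconst : ∀ x, (h x : ℂ) ^ n = (h x₀ : ℂ) ^ n := fun x =>
      hmin.eq_of_invariant (g := fun x => (h x : ℂ) ^ n) (by fun_prop) (fun x => by
        have := congrArg (fun z : Circle => (z : ℂ)) hwn
        simp only [Circle.coe_pow, Circle.coe_one] at this
        rw [hhw, Circle.coe_mul, mul_pow, this, one_mul]) _ _
    have hfin : (range fun x => (h x : ℂ)).Finite := by
      refine (Polynomial.nthRoots n ((h x₀ : ℂ) ^ n)).toFinset.finite_toSet.subset ?_
      rintro _ ⟨x, rfl⟩
      simpa [Polynomial.mem_nthRoots hn] using hconst x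
    have hsub := hfin.countable.isTotallyDisconnected _ subset_rfl
      (isPreconnected_range (by fun_prop))
    obtain ⟨y, z, hyz⟩ := hne
    apply hyz
    have := hsub ⟨y, rfl⟩ ⟨z, rfl⟩
    simp only [hcoe] at this
    have hr' : (‖g x₀‖ : ℂ) ≠ 0 := by exact_mod_cast hr
    exact (div_left_inj' hr').1 this
  refine ⟨h, w, hh, hhw, ?_⟩
  have hclosed : IsClosed (range h) := (isCompact_range hh).isClosed
  let G : AddSubgroup ℝ :=
    { carrier := {t | ∀ y, Circle.exp t * y ∈ range h ↔ y ∈ range h}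
      zero_mem' := fun y => by simp
      add_mem' := fun {s t} hs ht y => by
        rw [Circle.exp_add, mul_assoc, hs, ht]
      neg_mem' := fun {t} ht y => by
        rw [← ht, ← mul_assoc, ← Circle.exp_add, add_neg_cancel, Circle.exp_zero, one_mul] }
  have hGmem : ∀ t, t ∈ G ↔ ∀ y, Circle.exp t * y ∈ range h ↔ y ∈ range h := fun t => Iff.rfl
  obtain ⟨α, hα⟩ : ∃ α, Circle.exp α = w := ⟨_, Circle.exp_arg w⟩
  have hαG : α ∈ G := by
    rw [hGmem, hα]
    intro y
    constructor
    · rintro ⟨x, hx⟩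
      obtain ⟨x', rfl⟩ := hf.surjective x
      exact ⟨x', mul_left_cancel ((hhw x').symm.trans hx)⟩
    · rintro ⟨x, rfl⟩
      exact ⟨f x, hhw x⟩
  have hπG : 2 * Real.pi ∈ G := by
    rw [hGmem]
    simp
  have hdense : Dense (G : Set ℝ) := by
    refine (AddSubgroup.dense_or_cyclic G).resolve_right ?_
    rintro ⟨a, ha⟩
    rw [ha, AddSubgroup.mem_closure_singleton] at hαG hπG
    obtain ⟨l, hl⟩ := hαG
    obtain ⟨k, hk⟩ := hπG
    have hk0 : k ≠ 0 := by
      rintro rfl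
      have := Real.pi_pos
      simp at hk
    have hwk : w ^ k = 1 := by
      rw [← hα, ← Circle.exp_zsmul, ← hl, smul_smul, mul_comm, ← smul_smul, hk, Circle.exp_zsmul,
        Circle.exp_two_pi, one_zpow]
    refine hw k.natAbs (Int.natAbs_pos.2 hk0) ?_
    rcases Int.natAbs_eq k with h1 | h1
    · rw [← zpow_natCast, ← h1, hwk]
    · rw [← zpow_natCast, ← neg_neg (k.natAbs : ℤ), ← h1, zpow_neg, hwk, inv_one]
  intro y
  obtain ⟨t, ht⟩ : ∃ t, Circle.exp t = y / h x₀ := ⟨_, Circle.exp_arg _⟩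
  have hcl : IsClosed {t : ℝ | Circle.exp t * h x₀ ∈ range h} :=
    hclosed.preimage (by fun_prop)
  have hmem : t ∈ {t : ℝ | Circle.exp t * h x₀ ∈ range h} := by
    refine closure_minimal (s := (G : Set ℝ)) ?_ hcl (hdense t)
    intro s hs
    exact ((hGmem s).1 hs _).2 ⟨x₀, rfl⟩
  simpa [ht] using hmem

lemma norm_matrix_mul_le {m : ℕ} (M N : Matrix (Fin m) (Fin m) ℝ) :
    ‖M * N‖ ≤ m * ‖M‖ * ‖N‖ := by
  refine (Matrix.norm_le_iff (by positivity)).2 fun i j => ?_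
  rw [Matrix.mul_apply]
  refine (norm_sum_le _ _).trans ?_
  have : ∀ k ∈ (Finset.univ : Finset (Fin m)), ‖M i k * N k j‖ ≤ ‖M‖ * ‖N‖ := fun k _ => by
    rw [norm_mul]
    gcongr <;> exact Matrix.norm_entry_le_entrywise_sup_norm _
  refine (Finset.sum_le_card_nsmul _ _ _ this).trans ?_
  simp [mul_assoc]

lemma cocycle_succ' {X : Type*} {m : ℕ} (f : X → X) (A : X → Matrix (Fin m) (Fin m) ℝ) (n : ℕ)
    (x : X) : cocycle f A (n + 1) x = cocycle f A n (f x) * A x := by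
  induction n with
  | zero => simp [cocycle]
  | succ n ih =>
    rw [cocycle, ih, ← mul_assoc]
    rfl

lemma ContGL.isUnit_cocycle {X : Type*} [TopologicalSpace X] {m : ℕ} {f : X → X}
    {A : X → Matrix (Fin m) (Fin m) ℝ} (hA : ContGL A) (n : ℕ) (x : X) :
    IsUnit (cocycle f A n x) := by
  induction n with
  | zero => exact isUnit_one
  | succ n ih => exact (hA.2 _).mul ih

lemma ContGL.norm_cocycle_pos {X : Type*} [TopologicalSpace X] {m : ℕ} [NeZero m] {f : X → X}
    {A : X → Matrix (Fin m) (Fin m) ℝ} (hA : ContGL A) (n : ℕ) (x : X) :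
    0 < ‖cocycle f A n x‖ :=
  norm_pos_iff.2 (hA.isUnit_cocycle n x).ne_zero

lemma ContGL.continuous_cocycle {X : Type*} [TopologicalSpace X] {m : ℕ} {f : X → X}
    (hf : Continuous f) {A : X → Matrix (Fin m) (Fin m) ℝ} (hA : ContGL A) (n : ℕ) :
    Continuous (cocycle f A n) := by
  induction n with
  | zero => exact continuous_const
  | succ n ih => exact (hA.1.comp (hf.iterate n)).matrix_mul ih

/-- Over a minimal system the growth rate of a uniform cocycle is a constant. -/
lemma IsUniformCocycle.exists_const {X : Type*} [TopologicalSpace X] [Nonempty X] {m : ℕ}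
    [NeZero m] {f : X → X} (hf : Continuous f) (hmin : MinimalSys f)
    {A : X → Matrix (Fin m) (Fin m) ℝ} (hA : ContGL A) (hu : IsUniformCocycle f A) :
    ∃ L : ℝ, TendstoUniformly (fun (n : ℕ) (x : X) => Real.log ‖cocycle f A n x‖ / n)
      (fun _ => L) atTop := by
  obtain ⟨L, hL⟩ := hu
  have hLc : Continuous L := hL.continuous <| Frequently.of_forall fun n =>
    ((hA.continuous_cocycle hf n).norm.log fun x => (hA.norm_cocycle_pos n x).ne').div_const _
  have hinv : ∀ x, L (f x) = L x := fun x => by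
    set u : ℕ → ℝ := fun n => Real.log ‖cocycle f A n (f x)‖ with hu
    set v : ℕ → ℝ := fun n => Real.log ‖cocycle f A (n + 1) x‖ with hv
    have hut : Tendsto (fun n : ℕ => u n / n) atTop (𝓝 (L (f x))) := hL.tendsto_at (f x)
    have hvt : Tendsto (fun n : ℕ => v n / ((n + 1 : ℕ) : ℝ)) atTop (𝓝 (L x)) :=
      (hL.tendsto_at x).comp (tendsto_add_atTop_nat 1)
    obtain ⟨D, hD⟩ : ∃ D : ℝ, ∀ n, |v n - u n| ≤ D := by
      have hm : (0 : ℝ) < m := by exact_mod_cast Nat.pos_of_ne_zero (NeZero.ne m)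
      have h1 : 0 < ‖A x‖ := norm_pos_iff.2 (hA.2 x).ne_zero
      have hinvA : A x * (A x)⁻¹ = 1 :=
        Matrix.mul_nonsing_inv _ ((Matrix.isUnit_iff_isUnit_det _).1 (hA.2 x))
      have h2 : 0 < ‖(A x)⁻¹‖ := by
        refine norm_pos_iff.2 fun h => ?_
        rw [h, mul_zero] at hinvA
        exact zero_ne_one hinvA
      refine ⟨max (Real.log (m * ‖A x‖)) (Real.log (m * ‖(A x)⁻¹‖)), fun n => ?_⟩
      have hp := hA.norm_cocycle_pos (f := f) n (f x)
      have hq := hA.norm_cocycle_pos (f := f) (n + 1) x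
      have e1 : v n ≤ u n + Real.log (m * ‖A x‖) := by
        rw [hu, hv, ← Real.log_mul hp.ne' (by positivity)]
        refine Real.log_le_log hq ?_
        rw [cocycle_succ']
        exact (norm_matrix_mul_le _ _).trans_eq (by ring)
      have e2 : u n ≤ v n + Real.log (m * ‖(A x)⁻¹‖) := by
        rw [hu, hv, ← Real.log_mul hq.ne' (by positivity)]
        refine Real.log_le_log hp ?_
        have : cocycle f A n (f x) = cocycle f A (n + 1) x * (A x)⁻¹ := by
          rw [cocycle_succ', mul_assoc, hinvA, mul_one]
        rw [this]
        exact (norm_matrix_mul_le _ _).trans_eq (by ring)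
      rw [abs_le]
      constructor
      · linarith [le_max_right (Real.log (m * ‖A x‖)) (Real.log (m * ‖(A x)⁻¹‖))]
      · linarith [le_max_left (Real.log (m * ‖A x‖)) (Real.log (m * ‖(A x)⁻¹‖))]
    have hlim1 : Tendsto (fun n : ℕ => u n / n * ((n : ℝ) / ((n : ℝ) + 1))) atTop
        (𝓝 (L (f x) * 1)) := hut.mul (tendsto_natCast_div_add_atTop 1)
    have hlim2 : Tendsto (fun n : ℕ => (v n - u n) / ((n : ℝ) + 1)) atTop (𝓝 0) := by
      refine squeeze_zero_norm (fun n => ?_)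
        (tendsto_const_div_atTop_nhds_zero_nat D |>.comp (tendsto_add_atTop_nat 1))
      rw [Real.norm_eq_abs, abs_div, abs_of_pos (by positivity : (0 : ℝ) < (n : ℝ) + 1)]
      simp only [Function.comp, Nat.cast_add, Nat.cast_one]
      gcongr
      exact hD n
    have hlim := hlim1.add hlim2
    rw [mul_one, add_zero] at hlim
    refine tendsto_nhds_unique (hlim.congr' ?_) hvt
    filter_upwards [eventually_gt_atTop 0] with n hn
    have : (n : ℝ) ≠ 0 := by exact_mod_cast hn.ne'
    push_cast
    field_simp
    ring
  obtain ⟨x₀⟩ := ‹Nonempty X›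
  refine ⟨L x₀, ?_⟩
  have : L = fun _ => L x₀ := funext fun x => hmin.eq_of_invariant hLc hinv x x₀
  rwa [this] at hL
open scoped ComplexConjugate

lemma eq_of_exp_eq_one {k : ℝ → ℂ} (hk : Continuous k) (h : ∀ t, Complex.exp (k t) = 1) (s t : ℝ) :
    k s = k t := by
  have hcount : (range k).Countable := by
    refine (countable_range fun n : ℤ => (n : ℂ) * (2 * Real.pi * Complex.I)).mono ?_
    rintro _ ⟨t, rfl⟩
    obtain ⟨n, hn⟩ := Complex.exp_eq_one_iff.1 (h t)
    exact ⟨n, hn.symm⟩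
  exact hcount.isTotallyDisconnected _ subset_rfl (isPreconnected_range hk) ⟨s, rfl⟩ ⟨t, rfl⟩

/-- A nonvanishing continuous function on the line has a continuous logarithm. -/
lemma exists_continuous_log {t : ℝ → ℂ} (ht : Continuous t) (h0 : ∀ θ, t θ ≠ 0) :
    ∃ T : ℝ → ℂ, Continuous T ∧ ∀ θ, Complex.exp (T θ) = t θ := by
  have hcov := Complex.isCoveringMap_exp
  let F : C(ℝ, {z : ℂ // z ≠ 0}) := ⟨fun θ => ⟨t θ, h0 θ⟩, by fun_prop⟩
  obtain ⟨T, ⟨-, hT⟩, -⟩ := hcov.existsUnique_continuousMap_lifts F 0 (Complex.log (t 0))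
    (Subtype.ext (Complex.exp_log (h0 0)))
  exact ⟨T, T.continuous, fun θ => congrArg Subtype.val (congrFun hT θ)⟩

/-- A nonvanishing function on the circle has a winding number invariant under rotation, hence it
cannot change by a factor of winding number two under a rotation. -/
lemma false_of_rotation_eq_mul {t g : ℝ → ℂ} {α : ℝ} (ht : Continuous t) (hg : Continuous g)
    (htp : Function.Periodic t (2 * Real.pi)) (hgp : Function.Periodic g (2 * Real.pi))
    (h0 : ∀ θ, t θ ≠ 0)
    (h : ∀ θ, t (θ + α) = Complex.exp (2 * θ * Complex.I) * t θ * Complex.exp (g θ)) : False := by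
  obtain ⟨T, hT, hTt⟩ := exists_continuous_log ht h0
  have h1 : ∀ s t, T (s + 2 * Real.pi) - T s = T (t + 2 * Real.pi) - T t :=
    eq_of_exp_eq_one (k := fun s => T (s + 2 * Real.pi) - T s) (by fun_prop) fun s => by
      rw [Complex.exp_sub, hTt, hTt, htp, div_self (h0 s)]
  have h2 : ∀ s t : ℝ, T (s + α) - T s - 2 * s * Complex.I - g s
      = T (t + α) - T t - 2 * t * Complex.I - g t :=
    eq_of_exp_eq_one (k := fun s : ℝ => T (s + α) - T s - 2 * s * Complex.I - g s)
      (by fun_prop) fun s => by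
      rw [Complex.exp_sub, Complex.exp_sub, Complex.exp_sub, hTt, hTt, h]
      have := h0 s
      have := Complex.exp_ne_zero (2 * s * Complex.I)
      have := Complex.exp_ne_zero (g s)
      field_simp
  have e1 := h1 0 α
  have e2 := h2 0 (2 * Real.pi)
  have e3 := hgp 0
  simp only [zero_add] at e1 e2 e3
  rw [e3, add_comm (2 * Real.pi) α] at e2
  have : (4 * Real.pi * Complex.I : ℂ) = 0 := by
    push_cast at e2
    linear_combination e2 - e1
  simp [Real.pi_ne_zero] at this

/-- The real-linear map `v ↦ a v + b (conj v)` of the complex plane in matrix form. -/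
def realLinearMatrix (a b : ℂ) : Matrix (Fin 2) (Fin 2) ℝ :=
  !![a.re + b.re, b.im - a.im; a.im + b.im, a.re - b.re]

lemma realLinearMatrix_mul (a b a' b' : ℂ) :
    realLinearMatrix a b * realLinearMatrix a' b' =
      realLinearMatrix (a * a' + b * conj b') (a * b' + b * conj a') := by
  ext i j
  fin_cases i <;> fin_cases j <;> simp [realLinearMatrix, Matrix.mul_apply] <;> ring

lemma norm_realLinearMatrix_le (a b : ℂ) : ‖realLinearMatrix a b‖ ≤ ‖a‖ + ‖b‖ := by
  refine (Matrix.norm_le_iff (by positivity)).2 fun i j => ?_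
  have h1 := abs_le.1 (Complex.abs_re_le_norm a)
  have h2 := abs_le.1 (Complex.abs_re_le_norm b)
  have h3 := abs_le.1 (Complex.abs_im_le_norm a)
  have h4 := abs_le.1 (Complex.abs_im_le_norm b)
  rw [Real.norm_eq_abs, abs_le]
  fin_cases i <;> fin_cases j <;> simp [realLinearMatrix] <;> constructor <;> linarith

lemma norm_le_norm_realLinearMatrix (a b : ℂ) : ‖a‖ ≤ 2 * ‖realLinearMatrix a b‖ := by
  have h := fun i j => abs_le.1 ((Real.norm_eq_abs _).symm.trans_le
    (Matrix.norm_entry_le_entrywise_sup_norm (realLinearMatrix a b) (i := i) (j := j)))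
  generalize ‖realLinearMatrix a b‖ = r at h ⊢
  have h00 := h 0 0
  have h01 := h 0 1
  have h10 := h 1 0
  have h11 := h 1 1
  simp [realLinearMatrix] at h00 h01 h10 h11
  refine (Complex.norm_le_abs_re_add_abs_im a).trans ?_
  have h1 : |a.re| ≤ r := abs_le.2 ⟨by linarith, by linarith⟩
  have h2 : |a.im| ≤ r := abs_le.2 ⟨by linarith, by linarith⟩
  linarith

/-- The coefficients of the iterated cocycle generated by the maps
`v ↦ z (5/4 v + 3/4 (conj v))` over the rotation `z ↦ w z`. -/
def rotationPair (w : ℂ) : ℕ → ℂ → ℂ × ℂ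
  | 0, _ => (1, 0)
  | n + 1, z =>
    (w ^ n * z * (5 / 4 * (rotationPair w n z).1 + 3 / 4 * conj (rotationPair w n z).2),
      w ^ n * z * (5 / 4 * (rotationPair w n z).2 + 3 / 4 * conj (rotationPair w n z).1))

lemma rotationPair_succ' (w : ℂ) (n : ℕ) (z : ℂ) :
    rotationPair w (n + 1) z =
      (5 / 4 * z * (rotationPair w n (w * z)).1 + 3 / 4 * conj z * (rotationPair w n (w * z)).2,
        3 / 4 * z * (rotationPair w n (w * z)).1
          + 5 / 4 * conj z * (rotationPair w n (w * z)).2) := by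
  induction n with
  | zero => simp [rotationPair]; constructor <;> ring
  | succ n ih =>
    rw [rotationPair, ih]
    ext
    · simp only [rotationPair, map_add, map_mul, Complex.conj_conj, map_div₀, Complex.conj_ofNat]
      ring
    · simp only [rotationPair, map_add, map_mul, Complex.conj_conj, map_div₀, Complex.conj_ofNat]
      ring

lemma continuous_rotationPair (w : ℂ) (n : ℕ) : Continuous (rotationPair w n) := by
  induction n with
  | zero => exact continuous_const
  | succ n ih =>
    simp only [rotationPair]
    fun_prop

lemma norm_sq_rotationPair {w : ℂ} (hw : ‖w‖ = 1) (n : ℕ) {z : ℂ} (hz : ‖z‖ = 1) :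
    ‖(rotationPair w n z).1‖ ^ 2 = ‖(rotationPair w n z).2‖ ^ 2 + 1 := by
  induction n with
  | zero => simp [rotationPair]
  | succ n ih =>
    simp only [rotationPair, norm_mul, norm_pow, hw, hz, one_pow, one_mul]
    generalize (rotationPair w n z).1 = a at *
    generalize (rotationPair w n z).2 = b at *
    have e1 : (5 / 4 : ℂ) = ((5 / 4 : ℝ) : ℂ) := by norm_num
    have e2 : (3 / 4 : ℂ) = ((3 / 4 : ℝ) : ℂ) := by norm_num
    rw [e1, e2]
    simp only [← Complex.normSq_eq_norm_sq, Complex.normSq_apply, Complex.add_re, Complex.add_im,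
      Complex.re_ofReal_mul, Complex.im_ofReal_mul, Complex.conj_re, Complex.conj_im] at ih ⊢
    linear_combination ih

/-- The top Fourier coefficient of the first coefficient has modulus `(5/4)^n`. -/
lemma pow_le_of_norm_rotationPair_le {w : ℂ} (hw : ‖w‖ = 1) (n : ℕ) {C : ℝ}
    (hC : ∀ z : ℂ, ‖z‖ = 1 → ‖(rotationPair w n z).1‖ ≤ C) : (5 / 4 : ℝ) ^ n ≤ C := by
  obtain ⟨p, q, hp, hq, hp0, hq0, hpa, hqb⟩ : ∃ p q : ℂ → ℂ, Differentiable ℂ p ∧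
      Differentiable ℂ q ∧ ‖p 0‖ = (5 / 4 : ℝ) ^ n ∧ q 0 = 0 ∧
      (∀ z : ℂ, ‖z‖ = 1 → (rotationPair w n z).1 = z ^ n * p (conj z)) ∧
      ∀ z : ℂ, ‖z‖ = 1 → conj (rotationPair w n z).2 = z ^ n * q (conj z) := by
    clear hC
    induction n with
    | zero =>
      exact ⟨fun _ => 1, fun _ => 0, by fun_prop, by fun_prop, by simp, rfl,
        by simp [rotationPair], by simp [rotationPair]⟩
    | succ n ih =>
      obtain ⟨p, q, hp, hq, hp0, hq0, hpa, hqb⟩ := ih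
      refine ⟨fun u => w ^ n * (5 / 4 * p u + 3 / 4 * q u),
        fun u => conj w ^ n * u ^ 2 * (5 / 4 * q u + 3 / 4 * p u), by fun_prop, by fun_prop,
        ?_, by simp, fun z hz => ?_, fun z hz => ?_⟩
      · simp [hq0, hw, hp0, pow_succ, mul_comm]
      · simp only [rotationPair]
        rw [hpa z hz, hqb z hz]
        ring
      · have hzz : z * conj z = 1 := by
          rw [Complex.mul_conj, Complex.normSq_eq_norm_sq, hz]
          simp
        simp only [rotationPair, map_add, map_mul, Complex.conj_conj, map_div₀,
          Complex.conj_ofNat, map_pow]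
        rw [hpa z hz, hqb z hz]
        linear_combination (-(conj w ^ n * z ^ n * conj z *
          (5 / 4 * q (conj z) + 3 / 4 * p (conj z)))) * hzz
  rw [← hp0]
  refine Complex.norm_le_of_forall_mem_frontier_norm_le (U := Metric.ball 0 1)
    Metric.isBounded_ball hp.diffContOnCl (fun u hu => ?_)
    (subset_closure (Metric.mem_ball_self one_pos))
  rw [frontier_ball _ one_ne_zero, mem_sphere_zero_iff_norm] at hu
  have hz : ‖conj u‖ = 1 := by rw [Complex.norm_conj, hu]
  have := hC (conj u) hz
  rw [hpa _ hz, norm_mul, norm_pow, hz, one_pow, one_mul, Complex.conj_conj] at this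
  exact this

/-- The first coefficient of the iterated cocycle cannot be large over the whole circle. -/
lemma false_of_two_le_norm_rotationPair {w : ℂ} (hw : ‖w‖ = 1) (n : ℕ)
    (h : ∀ z : ℂ, ‖z‖ = 1 → 2 ≤ ‖(rotationPair w n z).1‖) : False := by
  obtain ⟨α, hα⟩ : ∃ α : ℝ, Complex.exp (α * Complex.I) = w := by
    refine ⟨w.arg, ?_⟩
    have := Complex.norm_mul_exp_arg_mul_I w
    rwa [hw, Complex.ofReal_one, one_mul] at this
  let E : ℝ → ℂ := fun θ => Complex.exp (θ * Complex.I)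
  have hE : Continuous E := by fun_prop
  have hEn : ∀ θ, ‖E θ‖ = 1 := fun θ => Complex.norm_exp_ofReal_mul_I θ
  have hEp : Function.Periodic E (2 * Real.pi) := fun θ => by
    simp only [E]
    push_cast
    rw [add_mul, Complex.exp_periodic]
  have hEα : ∀ θ, E (θ + α) = w * E θ := fun θ => by
    simp only [E]
    push_cast
    rw [add_mul, Complex.exp_add, hα, mul_comm]
  have hEc : ∀ θ, E θ * conj (E θ) = 1 := fun θ => by
    rw [Complex.mul_conj, Complex.normSq_eq_norm_sq, hEn]
    simp
  let a : ℝ → ℂ := fun θ => (rotationPair w n (E θ)).1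
  let b : ℝ → ℂ := fun θ => (rotationPair w n (E θ)).2
  have ha : Continuous a := (continuous_rotationPair w n).fst.comp hE
  have hb : Continuous b := (continuous_rotationPair w n).snd.comp hE
  have hap : Function.Periodic a (2 * Real.pi) := fun θ => by simp only [a, hEp θ]
  have hbp : Function.Periodic b (2 * Real.pi) := fun θ => by simp only [b, hEp θ]
  have hab : ∀ θ, ‖a θ‖ ^ 2 = ‖b θ‖ ^ 2 + 1 := fun θ => norm_sq_rotationPair hw n (hEn θ)
  have ha2 : ∀ θ, 2 ≤ ‖a θ‖ := fun θ => h _ (hEn θ)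
  have ha0 : ∀ θ, a θ ≠ 0 := fun θ => norm_pos_iff.1 (by linarith [ha2 θ])
  have hb1 : ∀ θ, 1 < ‖b θ‖ := fun θ => by nlinarith [hab θ, ha2 θ, norm_nonneg (b θ)]
  have hb0 : ∀ θ, b θ ≠ 0 := fun θ => norm_pos_iff.1 (by linarith [hb1 θ])
  have hlt1 : ∀ θ, 3 / 5 * (‖a θ‖ / ‖b θ‖) < 1 := fun θ => by
    have hbp : 0 < ‖b θ‖ := by linarith [hb1 θ]
    rw [← mul_div_assoc, div_lt_one hbp]
    nlinarith [hab θ, ha2 θ, hb1 θ]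
  have hlt2 : ∀ θ, 3 / 5 * (‖b θ‖ / ‖a θ‖) < 1 := fun θ => by
    have hap : 0 < ‖a θ‖ := by linarith [ha2 θ]
    rw [← mul_div_assoc, div_lt_one hap]
    nlinarith [hab θ, ha2 θ, hb1 θ]
  let F₁ : ℝ → ℂ := fun θ => 1 + 3 / 5 * (conj (a θ) / b θ)
  let F₂ : ℝ → ℂ := fun θ => 1 + 3 / 5 * (conj (b θ) / a θ)
  let G₁ : ℝ → ℂ := fun θ => 1 + 3 / 5 * (E θ ^ 2 * (a (θ + α) / b (θ + α)))
  let G₂ : ℝ → ℂ := fun θ => 1 + 3 / 5 * (conj (E θ) ^ 2 * (b (θ + α) / a (θ + α)))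
  have hF₁ : ∀ θ, F₁ θ ∈ Complex.slitPlane := fun θ =>
    Complex.mem_slitPlane_of_norm_lt_one (by simpa using hlt1 θ)
  have hF₂ : ∀ θ, F₂ θ ∈ Complex.slitPlane := fun θ =>
    Complex.mem_slitPlane_of_norm_lt_one (by simpa using hlt2 θ)
  have hG₁ : ∀ θ, G₁ θ ∈ Complex.slitPlane := fun θ =>
    Complex.mem_slitPlane_of_norm_lt_one (by simpa [hEn] using hlt1 (θ + α))
  have hG₂ : ∀ θ, G₂ θ ∈ Complex.slitPlane := fun θ =>
    Complex.mem_slitPlane_of_norm_lt_one (by simpa [hEn] using hlt2 (θ + α))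
  have haα : Continuous fun θ => a (θ + α) := ha.comp (continuous_add_const α)
  have hbα : Continuous fun θ => b (θ + α) := hb.comp (continuous_add_const α)
  have hEconj : Continuous fun θ => conj (E θ) := Complex.continuous_conj.comp hE
  have hF₁c : Continuous F₁ := continuous_const.add
    (continuous_const.mul ((Complex.continuous_conj.comp ha).div hb hb0))
  have hF₂c : Continuous F₂ := continuous_const.add
    (continuous_const.mul ((Complex.continuous_conj.comp hb).div ha ha0))
  have hG₁c : Continuous G₁ := continuous_const.add
    (continuous_const.mul ((hE.pow 2).mul (haα.div hbα fun _ => hb0 _)))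
  have hG₂c : Continuous G₂ := continuous_const.add
    (continuous_const.mul ((hEconj.pow 2).mul (hbα.div haα fun _ => ha0 _)))
  refine false_of_rotation_eq_mul (t := fun θ => b θ / a θ) (α := α)
    (g := fun θ => Complex.log (F₁ θ) + Complex.log (G₂ θ) - Complex.log (G₁ θ)
      - Complex.log (F₂ θ)) (hb.div ha ha0)
    ((((hF₁c.clog hF₁).add (hG₂c.clog hG₂)).sub (hG₁c.clog hG₁)).sub (hF₂c.clog hF₂))
    (hbp.div hap) ?_ (fun θ => div_ne_zero (hb0 θ) (ha0 θ)) fun θ => ?_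
  · intro θ
    simp only [F₁, F₂, G₁, G₂, add_right_comm θ (2 * Real.pi) α, hap _, hbp _, hEp _]
  · have f₁ := Complex.slitPlane_ne_zero (hF₁ θ)
    have f₂ := Complex.slitPlane_ne_zero (hF₂ θ)
    have g₁ := Complex.slitPlane_ne_zero (hG₁ θ)
    have g₂ := Complex.slitPlane_ne_zero (hG₂ θ)
    have hE2 : Complex.exp (2 * θ * Complex.I) = E θ ^ 2 := by
      simp only [E]
      rw [← Complex.exp_nat_mul]
      congr 1
      push_cast
      ring
    rw [hE2, Complex.exp_sub, Complex.exp_sub, Complex.exp_add, Complex.exp_log f₁,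
      Complex.exp_log f₂, Complex.exp_log g₁, Complex.exp_log g₂]
    have hz := hEc θ
    have hz0 : E θ ≠ 0 := left_ne_zero_of_mul_eq_one hz
    have hw0 : w ≠ 0 := norm_pos_iff.1 (by simp [hw])
    have hstep : rotationPair w (n + 1) (E θ) = _ := rotationPair_succ' w n (E θ)
    rw [← hEα] at hstep
    have h₁ := congrArg Prod.fst hstep
    have h₂ := congrArg Prod.snd hstep
    simp only [rotationPair] at h₁ h₂
    have k₁ : w ^ n * a θ * F₂ θ = a (θ + α) * G₂ θ := by
      have e₁ : a θ * F₂ θ = a θ + 3 / 5 * conj (b θ) := by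
        simp only [F₂]
        have := ha0 θ
        field_simp
      have e₂ : a (θ + α) * G₂ θ = a (θ + α) + 3 / 5 * conj (E θ) ^ 2 * b (θ + α) := by
        simp only [G₂]
        have := ha0 (θ + α)
        field_simp
      rw [mul_assoc, e₁, e₂]
      apply mul_left_cancel₀ hz0
      simp only [a, b]
      linear_combination (4 / 5) * h₁ - (3 / 5 * conj (E θ) *
        (rotationPair w n (E (θ + α))).2) * hz
    have k₂ : w ^ n * E θ ^ 2 * b θ * F₁ θ = b (θ + α) * G₁ θ := by
      have e₁ : b θ * F₁ θ = b θ + 3 / 5 * conj (a θ) := by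
        simp only [F₁]
        have := hb0 θ
        field_simp
      have e₂ : b (θ + α) * G₁ θ = b (θ + α) + 3 / 5 * E θ ^ 2 * a (θ + α) := by
        simp only [G₁]
        have := hb0 (θ + α)
        field_simp
      rw [mul_assoc, e₁, e₂]
      simp only [a, b]
      linear_combination (4 / 5 * E θ) * h₂ + (rotationPair w n (E (θ + α))).2 * hz
    have hwn := pow_ne_zero n hw0
    have := ha0 θ
    have := ha0 (θ + α)
    generalize F₁ θ = F₁ at *
    generalize F₂ θ = F₂ at *
    generalize G₁ θ = G₁ at *
    generalize G₂ θ = G₂ at *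
    change b (θ + α) / a (θ + α) = E θ ^ 2 * (b θ / a θ) * (F₁ * G₂ / G₁ / F₂)
    have k₃ : b (θ + α) = w ^ n * E θ ^ 2 * b θ * F₁ / G₁ := (eq_div_iff g₁).2 k₂.symm
    have k₄ : a (θ + α) = w ^ n * a θ * F₂ / G₂ := (eq_div_iff g₂).2 k₁.symm
    rw [k₃, k₄]
    field_simp

/-- Over a minimal system with a rotation of the circle as a factor there is a
non-uniform cocycle. -/
lemma exists_nonuniform_cocycle_of_circle_factor {X : Type*} [TopologicalSpace X] [Nonempty X]
    {f : X → X} (hf : Continuous f) (hmin : MinimalSys f) {h : X → Circle} {w : Circle}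
    (hh : Continuous h) (hw : ∀ x, h (f x) = w * h x) (hsurj : Function.Surjective h) :
    ∃ A : X → Matrix (Fin 2) (Fin 2) ℝ, ContGL A ∧ ¬ IsUniformCocycle f A := by
  let A : X → Matrix (Fin 2) (Fin 2) ℝ :=
    fun x => realLinearMatrix (5 / 4 * h x) (3 / 4 * h x)
  have hA : ContGL A := by
    constructor
    · refine continuous_matrix fun i j => ?_
      fin_cases i <;> fin_cases j <;> simp [A, realLinearMatrix] <;> fun_prop
    · intro x
      rw [Matrix.isUnit_iff_isUnit_det, isUnit_iff_ne_zero]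
      have hn : Complex.normSq (h x) = 1 := by simp
      rw [Complex.normSq_apply] at hn
      have : (A x).det = 1 := by
        simp [A, realLinearMatrix, Matrix.det_fin_two]
        linear_combination hn
      simp [this]
  have hit : ∀ n x, h (f^[n] x) = w ^ n * h x := fun n x => by
    induction n with
    | zero => simp
    | succ n ih => rw [Function.iterate_succ_apply', hw, ih, pow_succ', mul_assoc]
  have hcoc : ∀ n x, cocycle f A n x =
      realLinearMatrix (rotationPair w n (h x)).1 (rotationPair w n (h x)).2 := fun n x => by
    induction n with
    | zero =>
      ext i j
      fin_cases i <;> fin_cases j <;> simp [cocycle, rotationPair, realLinearMatrix]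
    | succ n ih =>
      rw [cocycle, ih, realLinearMatrix_mul, hit]
      simp only [rotationPair, Circle.coe_mul, Circle.coe_pow]
      congr 1 <;> ring
  have hwn : ‖(w : ℂ)‖ = 1 := w.norm_coe
  refine ⟨A, hA, fun hu => ?_⟩
  obtain ⟨L, hL⟩ := hu.exists_const hf hmin hA
  rw [Metric.tendstoUniformly_iff] at hL
  have hpos : 0 < Real.log (5 / 4) := Real.log_pos (by norm_num)
  set l := Real.log (5 / 4) with hl
  have hbig : ∀ n : ℕ, ∃ x, (5 / 4 : ℝ) ^ n / 4 < ‖cocycle f A n x‖ := fun n => by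
    by_contra! hcon
    have := pow_le_of_norm_rotationPair_le hwn n (C := (5 / 4 : ℝ) ^ n / 2) fun z hz => by
      obtain ⟨x, hx⟩ := hsurj ⟨z, mem_sphere_zero_iff_norm.2 hz⟩
      have hxz : (h x : ℂ) = z := by rw [hx]
      have := norm_le_norm_realLinearMatrix (rotationPair w n z).1 (rotationPair w n z).2
      rw [← hxz, ← hcoc] at this
      rw [← hxz]
      linarith [hcon x]
    have h54 : (0 : ℝ) < (5 / 4) ^ n := by positivity
    linarith
  have hlarge : ∀ᶠ n : ℕ in atTop, 4 * Real.log 4 / l < n :=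
    (tendsto_natCast_atTop_atTop).eventually_gt_atTop _
  obtain ⟨n, hn, hn4⟩ := ((hL (l / 4) (by positivity)).and hlarge).exists
  rw [div_lt_iff₀ hpos] at hn4
  have h4 : 0 < Real.log 4 := Real.log_pos (by norm_num)
  have hn0 : (0 : ℝ) < n := by
    by_contra! hc
    nlinarith
  obtain ⟨x₁, hx₁⟩ := hbig n
  have hLl : l / 2 < L := by
    have h1 := hn x₁
    have h2 : n * l - Real.log 4 < Real.log ‖cocycle f A n x₁‖ := by
      have := Real.log_lt_log (by positivity) hx₁
      rwa [Real.log_div (by positivity) (by norm_num), Real.log_pow] at this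
    rw [Real.dist_eq, abs_lt] at h1
    have h3 : l - l / 4 < Real.log ‖cocycle f A n x₁‖ / n := by
      rw [lt_div_iff₀ hn0]
      nlinarith
    linarith
  refine false_of_two_le_norm_rotationPair hwn n fun z hz => ?_
  obtain ⟨x, hx⟩ := hsurj ⟨z, mem_sphere_zero_iff_norm.2 hz⟩
  have hxz : (h x : ℂ) = z := by rw [hx]
  have h1 := hn x
  rw [Real.dist_eq, abs_lt] at h1
  have h2 : l / 4 < Real.log ‖cocycle f A n x‖ / n := by linarith
  rw [lt_div_iff₀ hn0] at h2
  have h3 : 4 < ‖cocycle f A n x‖ :=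
    (Real.log_lt_log_iff (by norm_num) (hA.norm_cocycle_pos n x)).1 (by linarith)
  have h4 := norm_realLinearMatrix_le (rotationPair w n z).1 (rotationPair w n z).2
  rw [← hxz, ← hcoc, hxz] at h4
  have h5 := norm_sq_rotationPair hwn n hz
  nlinarith [norm_nonneg (rotationPair w n z).1, norm_nonneg (rotationPair w n z).2]

/-- Over a uniquely ergodic map `f`, if an iterate is not uniquely ergodic then it is not
ergodic for the unique invariant measure of `f`. -/
lemma not_ergodic_iterate_of_not_uniquelyErgodic {X : Type*} [MeasurableSpace X] {f : X → X}
    {μ : Measure X} (hfm : Measurable f) (hμ : UniquelyErgodicWith f μ) {n : ℕ} (hn : 0 < n)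
    (hnu : ¬ UniquelyErgodic f^[n]) : ¬ Ergodic f^[n] μ := by
  intro herg
  have := hμ.1.1
  refine hnu ⟨μ, ⟨hμ.1.1, herg.map_eq⟩, fun ν ⟨hν, hνn⟩ => ?_⟩
  have hn0 : (n : ℝ≥0∞) ≠ 0 := by exact_mod_cast hn.ne'
  have hnt : (n : ℝ≥0∞) ≠ ∞ := ENNReal.natCast_ne_top n
  set σ : Measure X := ∑ i ∈ Finset.range n, ν.map f^[i] with hσ
  have hσf : σ.map f = σ := by
    have h1 : σ.map f = ∑ i ∈ Finset.range n, ν.map f^[i + 1] := by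
      rw [hσ, Measure.map_finset_sum hfm.aemeasurable]
      refine Finset.sum_congr rfl fun i _ => ?_
      rw [Measure.map_map hfm (hfm.iterate i), Function.iterate_succ']
    have h2 : (∑ i ∈ Finset.range n, ν.map f^[i + 1]) + ν.map f^[0] = σ + ν.map f^[n] := by
      rw [hσ, ← Finset.sum_range_succ, Finset.sum_range_succ']
    rw [hνn, Function.iterate_zero, Measure.map_id] at h2
    rw [h1]
    ext s hs
    have h3 := congrArg (fun m : Measure X => m s) h2
    simp only [Measure.add_apply] at h3
    exact (ENNReal.add_left_inj (measure_ne_top ν s)).1 h3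
  have hσuniv : σ univ = n := by
    simp [hσ, Measure.map_apply (hfm.iterate _) MeasurableSet.univ]
  have hinv : InvProb f ((n : ℝ≥0∞)⁻¹ • σ) := by
    refine ⟨⟨?_⟩, ?_⟩
    · rw [Measure.smul_apply, hσuniv, smul_eq_mul, ENNReal.inv_mul_cancel hn0 hnt]
    · rw [Measure.map_smul, hσf]
  have hac : ν ≪ μ := by
    rw [← hμ.2 _ hinv]
    intro s hs
    rw [Measure.smul_apply, smul_eq_mul, mul_eq_zero, ENNReal.inv_eq_zero] at hs
    have h1 := hs.resolve_left hnt
    rw [hσ, Measure.finsetSum_apply, Finset.sum_eq_zero_iff] at h1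
    simpa using h1 0 (Finset.mem_range.2 hn)
  exact herg.eq_of_absolutelyContinuous ⟨hfm.iterate n, hνn⟩ hac

/-- If an iterate `f^n` is not ergodic then it has a nontrivial invariant set whose translates
under `f` either coincide with it or are almost disjoint from it. -/
lemma exists_invariant_set_of_not_ergodic_iterate {X : Type*} [MeasurableSpace X] {f : X → X}
    {μ : Measure X} (hf : MeasurePreserving f μ μ) (hsurj : Function.Surjective f) {n : ℕ}
    (hn : 0 < n) (hne : ¬ Ergodic f^[n] μ) :
    ∃ F : Set X, MeasurableSet F ∧ f^[n] ⁻¹' F = F ∧ μ F ≠ 0 ∧ μ Fᶜ ≠ 0 ∧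
      ∀ i, μ (F ∩ f^[i] ⁻¹' F) = 0 ∨ f^[i] ⁻¹' F = F := by
  classical
  obtain ⟨E, hE, hEn, hE0, hE1⟩ : ∃ E, MeasurableSet E ∧ f^[n] ⁻¹' E = E ∧ μ E ≠ 0 ∧
      μ Eᶜ ≠ 0 := by
    by_contra! hcon
    refine hne ⟨hf.iterate n, ⟨fun s hs hsn => ?_⟩⟩
    rw [eventuallyConst_set']
    by_cases h0 : μ s = 0
    · exact Or.inl (ae_eq_empty.2 h0)
    · exact Or.inr (ae_eq_univ.2 (hcon s hs hsn h0))
  set 𝓔 : Finset (Set X) := (Finset.range n).image fun i => f^[i] ⁻¹' E with h𝓔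
  have hpre : ∀ G ∈ 𝓔, f ⁻¹' G ∈ 𝓔 := fun G hG => by
    obtain ⟨i, hi, rfl⟩ := Finset.mem_image.1 hG
    rw [← preimage_comp, ← Function.iterate_succ]
    rcases (Nat.succ_le_of_lt (Finset.mem_range.1 hi)).lt_or_eq with h | h
    · exact Finset.mem_image.2 ⟨i + 1, Finset.mem_range.2 h, rfl⟩
    · rw [h, hEn]
      exact Finset.mem_image.2 ⟨0, Finset.mem_range.2 hn, rfl⟩
  have hprei : ∀ i, ∀ G ∈ 𝓔, f^[i] ⁻¹' G ∈ 𝓔 := fun i => by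
    induction i with
    | zero => exact fun G hG => hG
    | succ i ih =>
      intro G hG
      rw [Function.iterate_succ, preimage_comp]
      exact hpre _ (ih G hG)
  have hpren : ∀ G ∈ 𝓔, f^[n] ⁻¹' G = G := fun G hG => by
    obtain ⟨i, -, rfl⟩ := Finset.mem_image.1 hG
    rw [← preimage_comp, ← Function.iterate_add, add_comm, Function.iterate_add, preimage_comp,
      hEn]
  have hmeas : ∀ G ∈ 𝓔, MeasurableSet G := fun G hG => by
    obtain ⟨i, -, rfl⟩ := Finset.mem_image.1 hG
    exact (hf.iterate i).measurable hE
  have hcompl : ∀ G ∈ 𝓔, μ Gᶜ ≠ 0 := fun G hG => by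
    obtain ⟨i, -, rfl⟩ := Finset.mem_image.1 hG
    rwa [← preimage_compl, (hf.iterate i).measure_preimage hE.compl.nullMeasurableSet]
  obtain ⟨T, hT, hTmax⟩ := Finset.exists_max_image
    (𝓔.powerset.filter fun T : Finset (Set X) => μ (⋂₀ (T : Set (Set X))) ≠ 0) Finset.card
    ⟨{E}, by
      rw [Finset.mem_filter, Finset.mem_powerset, Finset.singleton_subset_iff]
      refine ⟨Finset.mem_image.2 ⟨0, Finset.mem_range.2 hn, rfl⟩, ?_⟩
      simpa using hE0⟩
  rw [Finset.mem_filter, Finset.mem_powerset] at hT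
  obtain ⟨hT𝓔, hT0⟩ := hT
  have hcard : 0 < T.card := by
    refine (Finset.card_pos.2 (Finset.singleton_nonempty E)).trans_le (hTmax {E} ?_)
    rw [Finset.mem_filter, Finset.mem_powerset, Finset.singleton_subset_iff]
    refine ⟨Finset.mem_image.2 ⟨0, Finset.mem_range.2 hn, rfl⟩, ?_⟩
    simpa using hE0
  obtain ⟨G, hG⟩ := Finset.card_pos.1 hcard
  have hpreT : ∀ i, f^[i] ⁻¹' ⋂₀ (T : Set (Set X)) =
      ⋂₀ ((T.image fun G => f^[i] ⁻¹' G : Finset (Set X)) : Set (Set X)) := fun i => by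
    ext x
    simp
  refine ⟨⋂₀ (T : Set (Set X)),
    MeasurableSet.sInter T.countable_toSet fun G hG => hmeas G (hT𝓔 hG), ?_, hT0, ?_, fun i => ?_⟩
  · rw [hpreT]
    congr 2
    refine (Finset.image_congr fun G hG => hpren G (hT𝓔 hG)).trans Finset.image_id
  · exact fun h => hcompl G (hT𝓔 hG)
      (measure_mono_null (compl_subset_compl.2 (sInter_subset_of_mem hG)) h)
  · rw [or_iff_not_imp_left]
    intro h0
    rw [hpreT] at h0 ⊢
    set T' := T.image fun G => f^[i] ⁻¹' G with hT'
    have hcardT' : T'.card = T.card :=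
      Finset.card_image_of_injective _ (hsurj.iterate i).preimage_injective
    have hle := hTmax (T ∪ T') <| by
      rw [Finset.mem_filter, Finset.mem_powerset]
      refine ⟨Finset.union_subset hT𝓔 fun G hG => ?_, ?_⟩
      · obtain ⟨G', hG', rfl⟩ := Finset.mem_image.1 hG
        exact hprei i _ (hT𝓔 hG')
      · rwa [Finset.coe_union, sInter_union]
    have h1 : T = T ∪ T' := Finset.eq_of_subset_of_card_le Finset.subset_union_left hle
    have h2 : T' = T := Finset.eq_of_subset_of_card_le
      (by rw [h1]; exact Finset.subset_union_right) hcardT'.ge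
    rw [h2]

/-- If some iterate of an ergodic map is not ergodic, then the map has a nontrivial finite
cyclic factor. -/
lemma Ergodic.exists_cyclic_set {X : Type*} [MeasurableSpace X] {f : X → X}
    {μ : Measure X} [IsProbabilityMeasure μ] (hf : Ergodic f μ) (hsurj : Function.Surjective f)
    {n : ℕ} (hn : 0 < n) (hne : ¬ Ergodic f^[n] μ) :
    ∃ (d : ℕ) (F : Set X), 2 ≤ d ∧ MeasurableSet F ∧ f^[d] ⁻¹' F = F ∧ μ F = (d : ℝ≥0∞)⁻¹ := by
  classical
  obtain ⟨F, hF, hFn, hF0, hF1, hdisj⟩ :=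
    exists_invariant_set_of_not_ergodic_iterate hf.toMeasurePreserving hsurj hn hne
  have hex : ∃ i, 0 < i ∧ f^[i] ⁻¹' F = F := ⟨n, hn, hFn⟩
  obtain ⟨d, ⟨hd0, hdF⟩, hdmin⟩ : ∃ d, (0 < d ∧ f^[d] ⁻¹' F = F) ∧
      ∀ i < d, ¬ (0 < i ∧ f^[i] ⁻¹' F = F) :=
    ⟨Nat.find hex, Nat.find_spec hex, fun i hi => Nat.find_min hex hi⟩
  have htriv : ∀ G, MeasurableSet G → f ⁻¹' G = G → μ G ≠ 0 → μ Gᶜ = 0 := fun G hG hfG hG0 => by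
    rcases hf.quasiErgodic.ae_empty_or_univ₀ hG.nullMeasurableSet hfG.eventuallyEq with h | h
    · exact absurd (ae_eq_empty.1 h) hG0
    · exact ae_eq_univ.1 h
  have hpre := hf.toMeasurePreserving
  refine ⟨d, F, ?_, hF, hdF, ?_⟩
  · by_contra! hlt
    have hd1 : d = 1 := by omega
    subst hd1
    exact hF1 (htriv F hF hdF hF0)
  · have hm : ∀ i, MeasurableSet (f^[i] ⁻¹' F) := fun i => (hpre.iterate i).measurable hF
    have hzero : ∀ i j, i < j → j < d → μ (f^[i] ⁻¹' F ∩ f^[j] ⁻¹' F) = 0 := fun i j hij hj => by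
      obtain ⟨l, rfl⟩ := Nat.exists_eq_add_of_lt hij
      have : f^[i] ⁻¹' F ∩ f^[i + l + 1] ⁻¹' F = f^[i] ⁻¹' (F ∩ f^[l + 1] ⁻¹' F) := by
        rw [preimage_inter, ← preimage_comp, ← Function.iterate_add]
        congr 3
        ring
      rw [this, (hpre.iterate i).measure_preimage (hF.inter (hm _)).nullMeasurableSet]
      exact (hdisj (l + 1)).resolve_right fun h => hdmin (l + 1) (by omega) ⟨l.succ_pos, h⟩
    set G := ⋃ i ∈ Finset.range d, f^[i] ⁻¹' F with hG
    have hGm : MeasurableSet G := Finset.measurableSet_biUnion _ fun i _ => hm i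
    have hfG : f ⁻¹' G = G := by
      ext x
      simp only [hG, mem_preimage, mem_iUnion, Finset.mem_range, exists_prop,
        ← Function.iterate_succ_apply]
      constructor
      · rintro ⟨i, hi, h⟩
        rcases (Nat.succ_le_of_lt hi).lt_or_eq with h' | h'
        · exact ⟨i + 1, h', h⟩
        · refine ⟨0, hd0, ?_⟩
          rw [h'] at h
          exact hdF.subset h
      · rintro ⟨i, hi, h⟩
        rcases i with - | i
        · refine ⟨d - 1, by omega, ?_⟩
          rw [Nat.succ_eq_add_one, Nat.sub_add_cancel hd0]
          exact hdF.superset h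
        · exact ⟨i, by omega, h⟩
    have hFG : F ⊆ G := fun x hx => by
      rw [hG]
      exact mem_biUnion (Finset.mem_range.2 hd0) hx
    have hG1 : μ G = 1 := by
      rw [← prob_compl_eq_zero_iff hGm]
      exact htriv G hGm hfG fun h => hF0 (measure_mono_null hFG h)
    have hsum : μ G = ∑ i ∈ Finset.range d, μ (f^[i] ⁻¹' F) := by
      refine measure_biUnion_finset₀ (fun i hi j hj hij => ?_)
        fun i _ => (hm i).nullMeasurableSet
      simp only [Finset.coe_range, mem_Iio] at hi hj
      rcases lt_or_gt_of_ne hij with h | h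
      · exact hzero i j h hj
      · change μ _ = 0
        rw [inter_comm]
        exact hzero j i h hi
    have hμi : ∀ i, μ (f^[i] ⁻¹' F) = μ F := fun i =>
      (hpre.iterate i).measure_preimage hF.nullMeasurableSet
    simp only [hμi, Finset.sum_const, Finset.card_range, nsmul_eq_mul] at hsum
    rw [hG1] at hsum
    rw [mul_comm] at hsum
    exact ENNReal.eq_inv_of_mul_eq_one_left hsum.symm

/-- Sum of `φ` along the orbit of `x` over the times at which the orbit of `i` under the
permutation `p` visits `i₀`. -/
def visitSum {X : Type*} {m : ℕ} (f : X → X) (φ : X → ℝ) (p : Equiv.Perm (Fin m)) (i₀ : Fin m)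
    (n : ℕ) (i : Fin m) (x : X) : ℝ :=
  ∑ l ∈ Finset.range n, if (p ^ l) i = i₀ then φ (f^[l] x) else 0

/-- Permutation matrix of `p` with the entry in column `i₀` replaced by `exp (φ x)`. -/
def weightedPerm {X : Type*} {m : ℕ} (φ : X → ℝ) (p : Equiv.Perm (Fin m)) (i₀ : Fin m) (x : X) :
    Matrix (Fin m) (Fin m) ℝ :=
  Matrix.of fun j i => if j = p i then Real.exp (if i = i₀ then φ x else 0) else 0

section visitSum

variable {X : Type*} {m : ℕ} {f : X → X} {φ : X → ℝ} {p : Equiv.Perm (Fin m)} {i₀ : Fin m}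

lemma continuous_visitSum [TopologicalSpace X] (hf : Continuous f) (hφ : Continuous φ) (n : ℕ)
    (i : Fin m) : Continuous (visitSum f φ p i₀ n i) := by
  refine continuous_finsetSum _ fun l _ => ?_
  split_ifs
  · exact hφ.comp (hf.iterate l)
  · exact continuous_const

lemma visitSum_nonneg (hφ : ∀ x, 0 ≤ φ x) (n : ℕ) (i : Fin m) (x : X) :
    0 ≤ visitSum f φ p i₀ n i x := by
  refine Finset.sum_nonneg fun l _ => ?_
  split_ifs
  · exact hφ _
  · exact le_rfl

lemma sum_visitSum (n : ℕ) (x : X) :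
    ∑ i, visitSum f φ p i₀ n i x = ∑ l ∈ Finset.range n, φ (f^[l] x) := by
  unfold visitSum
  rw [Finset.sum_comm]
  refine Finset.sum_congr rfl fun l _ => ?_
  rw [Equiv.sum_comp (p ^ l) fun j => if j = i₀ then φ (f^[l] x) else 0]
  simp

lemma visitSum_succ' (n : ℕ) (i : Fin m) (x : X) :
    visitSum f φ p i₀ (n + 1) i x =
      visitSum f φ p i₀ n (p i) (f x) + if i = i₀ then φ x else 0 := by
  unfold visitSum
  rw [Finset.sum_range_succ']
  simp [pow_succ]

lemma visitSum_le_visitSum_map (hφ : ∀ x, 0 ≤ φ x) (hφ1 : ∀ x, φ x ≤ 1) (n : ℕ) (i : Fin m)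
    (x : X) : visitSum f φ p i₀ n i x ≤ visitSum f φ p i₀ n (p i) (f x) + 1 := by
  have h1 : visitSum f φ p i₀ n i x ≤ visitSum f φ p i₀ (n + 1) i x := by
    unfold visitSum
    rw [Finset.sum_range_succ]
    split_ifs
    · linarith [hφ (f^[n] x)]
    · linarith
  rw [visitSum_succ'] at h1
  split_ifs at h1
  · linarith [hφ1 x]
  · linarith

lemma sum_le_visitSum {d : ℕ} (hd : 0 < d) (hp : p ^ d = 1) (hφ : ∀ x, 0 ≤ φ x) (k : ℕ) (x : X) :
    ∑ l ∈ Finset.range k, φ (f^[d * l] x) ≤ visitSum f φ p i₀ (d * k) i₀ x := by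
  have h1 : ∑ l ∈ Finset.range k, φ (f^[d * l] x) =
      ∑ l ∈ (Finset.range k).image (d * ·), if (p ^ l) i₀ = i₀ then φ (f^[l] x) else 0 := by
    rw [Finset.sum_image fun a _ b _ h => Nat.eq_of_mul_eq_mul_left hd h]
    refine Finset.sum_congr rfl fun l _ => ?_
    simp [pow_mul, hp]
  rw [h1]
  refine Finset.sum_le_sum_of_subset_of_nonneg ?_ fun l _ _ => ?_
  · intro a ha
    obtain ⟨l, hl, rfl⟩ := Finset.mem_image.1 ha
    exact Finset.mem_range.2 (Nat.mul_lt_mul_of_pos_left (Finset.mem_range.1 hl) hd)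
  · split_ifs
    · exact hφ _
    · exact le_rfl

lemma cocycle_weightedPerm (n : ℕ) (x : X) (j i : Fin m) :
    cocycle f (weightedPerm φ p i₀) n x j i =
      if j = (p ^ n) i then Real.exp (visitSum f φ p i₀ n i x) else 0 := by
  induction n generalizing j with
  | zero => simp [cocycle, visitSum, Matrix.one_apply]
  | succ n ih =>
    rw [cocycle, Matrix.mul_apply]
    simp only [ih, mul_ite, mul_zero, Finset.sum_ite_eq', Finset.mem_univ, if_true,
      weightedPerm, Matrix.of_apply]
    rw [pow_succ', Equiv.Perm.mul_apply]
    split_ifs with h1 h2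
    · rw [← Real.exp_add, visitSum, visitSum, Finset.sum_range_succ, if_pos h2, add_comm]
    · rw [← Real.exp_add, visitSum, visitSum, Finset.sum_range_succ, if_neg h2, add_comm]
    · simp

lemma contGL_weightedPerm [TopologicalSpace X] (hφ : Continuous φ) :
    ContGL (weightedPerm φ p i₀) := by
  refine ⟨continuous_matrix fun j i => ?_, fun x => ?_⟩
  · simp only [weightedPerm, Matrix.of_apply]
    split_ifs
    · exact hφ.rexp
    · exact continuous_const
    · exact continuous_const
  · refine IsUnit.of_mul_eq_one (Matrix.of fun i j => if j = p i then Real.exp (-if i = i₀ then φ x else 0) else 0) ?_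
    ext j k
    rw [Matrix.mul_apply]
    simp only [weightedPerm, Matrix.of_apply]
    rw [Finset.sum_eq_single (p.symm j)]
    · simp only [Equiv.apply_symm_apply, if_true, Matrix.one_apply]
      by_cases h : j = k
      · subst h
        simp [← Real.exp_add]
      · simp [h, Ne.symm h]
    · intro b _ hb
      rw [if_neg fun h => hb (by simp [h]), zero_mul]
    · simp

lemma exp_visitSum_le_norm_cocycle (n : ℕ) (i : Fin m) (x : X) :
    Real.exp (visitSum f φ p i₀ n i x) ≤ ‖cocycle f (weightedPerm φ p i₀) n x‖ := by
  have := Matrix.norm_entry_le_entrywise_sup_norm (cocycle f (weightedPerm φ p i₀) n x)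
    (i := (p ^ n) i) (j := i)
  rwa [cocycle_weightedPerm, if_pos rfl, Real.norm_eq_abs, Real.abs_exp] at this

lemma norm_cocycle_weightedPerm_le (n : ℕ) (x : X) {t : ℝ}
    (ht : ∀ i, visitSum f φ p i₀ n i x ≤ t) :
    ‖cocycle f (weightedPerm φ p i₀) n x‖ ≤ Real.exp t := by
  refine (Matrix.norm_le_iff (Real.exp_pos t).le).2 fun j i => ?_
  rw [cocycle_weightedPerm]
  split_ifs
  · rw [Real.norm_eq_abs, Real.abs_exp]
    exact Real.exp_le_exp.2 (ht i)
  · simpa using (Real.exp_pos t).le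

end visitSum

lemma cocycle_smul_one {X : Type*} {m : ℕ} (f : X → X) (φ : X → ℝ) (n : ℕ) (x : X) :
    cocycle f (fun x => Real.exp (φ x) • (1 : Matrix (Fin m) (Fin m) ℝ)) n x =
      Real.exp (∑ l ∈ Finset.range n, φ (f^[l] x)) • 1 := by
  induction n with
  | zero => simp [cocycle]
  | succ n ih =>
    rw [cocycle, ih, Finset.sum_range_succ, Real.exp_add]
    simp [smul_smul, mul_comm]

lemma norm_smul_one_fin_two (c : ℝ) : ‖c • (1 : Matrix (Fin 2) (Fin 2) ℝ)‖ = |c| := by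
  refine le_antisymm ((Matrix.norm_le_iff (abs_nonneg c)).2 fun i j => ?_) ?_
  · by_cases h : i = j <;> simp [h]
  · have := Matrix.norm_entry_le_entrywise_sup_norm (c • (1 : Matrix (Fin 2) (Fin 2) ℝ))
      (i := 0) (j := 0)
    simpa using this

/-- The elements of a family of pairwise disjoint open sets covering a connected space are
trivial. -/
lemma eq_univ_of_pairwise_disjoint_cover {X ι : Type*} [TopologicalSpace X] [PreconnectedSpace X]
    {U : ι → Set X} (hU : ∀ i, IsOpen (U i)) (hd : ∀ i j, i ≠ j → Disjoint (U i) (U j))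
    (hc : ∀ x, ∃ i, x ∈ U i) {i : ι} (hi : (U i).Nonempty) : U i = univ := by
  refine IsClopen.eq_univ ⟨⟨?_⟩, hU i⟩ hi
  have : (U i)ᶜ = ⋃ (j) (_ : j ≠ i), U j := by
    ext x
    simp only [mem_compl_iff, mem_iUnion, exists_prop]
    constructor
    · intro hx
      obtain ⟨j, hj⟩ := hc x
      exact ⟨j, fun h => hx (h ▸ hj), hj⟩
    · rintro ⟨j, hji, hj⟩ hx
      exact (disjoint_left.1 (hd j i hji)) hj hx
  rw [this]
  exact isOpen_iUnion fun j => isOpen_iUnion fun _ => hU j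

/-- A measurable set is approximated in mean by continuous functions with values in `[0, 1]`. -/
lemma exists_continuous_approx_indicator {X : Type*} [MetricSpace X] [CompactSpace X]
    [MeasurableSpace X] [BorelSpace X] (μ : Measure X) [IsProbabilityMeasure μ] {F : Set X}
    (hF : MeasurableSet F) {ε : ℝ} (hε : 0 < ε) :
    ∃ φ : X → ℝ, Continuous φ ∧ (∀ x, 0 ≤ φ x) ∧ (∀ x, φ x ≤ 1) ∧
      ∫ x, φ x ∂μ < μ.real F + ε ∧ μ.real F - ε < ∫ x in F, φ x ∂μ := by
  have hε' : ENNReal.ofReal ε ≠ 0 := by simpa using hε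
  obtain ⟨U, hFU, hU, hμU⟩ := F.exists_isOpen_lt_add (measure_ne_top μ F) hε'
  obtain ⟨K, hKF, hK, hμK⟩ := hF.exists_isClosed_lt_add (measure_ne_top μ F) hε'
  have hUr : μ.real U < μ.real F + ε := by
    have := (ENNReal.toReal_lt_toReal (measure_ne_top _ _) (by finiteness)).2 hμU
    rwa [ENNReal.toReal_add (by finiteness) (by finiteness), ENNReal.toReal_ofReal hε.le] at this
  have hKr : μ.real F < μ.real K + ε := by
    have := (ENNReal.toReal_lt_toReal (measure_ne_top _ _) (by finiteness)).2 hμK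
    rwa [ENNReal.toReal_add (by finiteness) (by finiteness), ENNReal.toReal_ofReal hε.le] at this
  obtain ⟨φ, h0, h1, h01⟩ := exists_continuous_zero_one_of_isClosed hU.isClosed_compl hK
    (disjoint_left.2 fun x hx hxK => hx (hFU (hKF hxK)))
  have hφi := integrable_of_continuous μ φ.continuous
  refine ⟨φ, φ.continuous, fun x => (h01 x).1, fun x => (h01 x).2, ?_, ?_⟩
  · refine lt_of_le_of_lt ?_ hUr
    rw [← integral_indicator_one hU.measurableSet]
    refine integral_mono hφi ((integrable_const (1 : ℝ)).indicator hU.measurableSet) fun x => ?_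
    by_cases hx : x ∈ U
    · simpa [hx] using (h01 x).2
    · simpa [hx] using (h0 hx).le
  · refine lt_of_lt_of_le (by linarith : μ.real F - ε < μ.real K) ?_
    calc μ.real K = ∫ x in K, φ x ∂μ := by
          rw [setIntegral_congr_fun hK.measurableSet h1]
          simp
      _ ≤ ∫ x in F, φ x ∂μ :=
          setIntegral_mono_set hφi.integrableOn (ae_of_all _ fun x => (h01 x).1)
            hKF.eventuallyLE

/-- A set with `d` cyclic translates of measure `1 / d`, all invariant under `f^[d]`, yields a
nonuniform cocycle over a connected space. -/
lemma exists_nonuniform_cocycle_of_cyclic_set {X : Type*} [MetricSpace X] [CompactSpace X]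
    [ConnectedSpace X] [MeasurableSpace X] [BorelSpace X] {f : X → X} {μ : Measure X}
    [IsProbabilityMeasure μ] (hf : Continuous f) (hmin : MinimalSys f)
    (hpre : MeasurePreserving f μ μ) {d : ℕ} (hd : 2 ≤ d) {F : Set X} (hF : MeasurableSet F)
    (hdF : f^[d] ⁻¹' F = F) (hμF : μ F = (d : ℝ≥0∞)⁻¹) :
    ∃ m : ℕ, 2 ≤ m ∧ ∃ A : X → Matrix (Fin m) (Fin m) ℝ, ContGL A ∧ ¬ IsUniformCocycle f A := by
  obtain ⟨e, rfl⟩ : ∃ e, d = e + 2 := ⟨d - 2, by omega⟩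
  set d := e + 2 with hde
  have hd0 : (0 : ℝ) < d := by positivity
  set r : ℝ := (d : ℝ)⁻¹ with hr
  have hr0 : 0 < r := by positivity
  have hrF : μ.real F = r := by
    rw [measureReal_def, hμF, ENNReal.toReal_inv, ENNReal.toReal_natCast]
  obtain ⟨φ, hφ, hφ0, hφ1, hup, hlo⟩ :=
    exists_continuous_approx_indicator μ hF (by positivity : 0 < r / 8)
  rw [hrF] at hup hlo
  have hiter : ∀ l, Continuous fun x => φ (f^[l] x) := fun l => hφ.comp (hf.iterate l)
  by_contra hcon
  push Not at hcon
  -- uniformity of the scalar cocycle bounds the Birkhoff sums of `φ`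
  have hA₀ : ContGL fun x => Real.exp (φ x) • (1 : Matrix (Fin 2) (Fin 2) ℝ) := by
    refine ⟨hφ.rexp.smul continuous_const, fun x => ?_⟩
    exact isUnit_one.smul (Units.mk0 _ (Real.exp_pos (φ x)).ne')
  obtain ⟨c, hc⟩ := (hcon 2 le_rfl _ hA₀).exists_const hf hmin hA₀
  simp only [cocycle_smul_one, norm_smul_one_fin_two, Real.abs_exp, Real.log_exp] at hc
  have hint : ∀ n : ℕ, ∫ x, ∑ l ∈ Finset.range n, φ (f^[l] x) ∂μ = n * ∫ x, φ x ∂μ := fun n => by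
    rw [integral_finsetSum _ fun l _ => integrable_of_continuous μ (hiter l)]
    simp [fun l => integral_comp_of_measurePreserving (hpre.iterate l) hφ]
  have hcle : c ≤ ∫ x, φ x ∂μ := by
    refine le_of_forall_pos_le_add fun δ hδ => ?_
    obtain ⟨n, hn, hn0⟩ :=
      ((Metric.tendstoUniformly_iff.1 hc δ hδ).and (eventually_gt_atTop 0)).exists
    have hn0' : (0 : ℝ) < n := by exact_mod_cast hn0
    have h1 : ∀ x, n * (c - δ) ≤ ∑ l ∈ Finset.range n, φ (f^[l] x) := fun x => by
      have := hn x
      rw [Real.dist_eq, abs_lt] at this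
      have h2 : c - δ ≤ (∑ l ∈ Finset.range n, φ (f^[l] x)) / n := by linarith
      rw [le_div_iff₀ hn0'] at h2
      linarith
    have h3 := integral_mono (μ := μ) (integrable_const (n * (c - δ)))
      (integrable_of_continuous μ (continuous_finsetSum _ fun l _ => hiter l)) h1
    rw [hint] at h3
    simp only [integral_const, probReal_univ, one_smul] at h3
    linarith [le_of_mul_le_mul_left h3 hn0']
  have hbirk : ∀ᶠ n : ℕ in atTop, ∀ x,
      ∑ l ∈ Finset.range n, φ (f^[l] x) < 10 / 8 * r * n := by
    filter_upwards [Metric.tendstoUniformly_iff.1 hc (r / 8) (by positivity),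
      eventually_gt_atTop 0] with n hn hn0 x
    have hn0' : (0 : ℝ) < n := by exact_mod_cast hn0
    have := hn x
    rw [Real.dist_eq, abs_lt] at this
    have h2 : (∑ l ∈ Finset.range n, φ (f^[l] x)) / n < 10 / 8 * r := by linarith
    rwa [div_lt_iff₀ hn0'] at h2
  -- the growth rate of the weighted permutation cocycle
  set p : Equiv.Perm (Fin d) := finRotate d with hp
  have hpd : p ^ d = 1 := by
    have := pow_orderOf_eq_one p
    rwa [hp, (isCycle_finRotate).orderOf, support_finRotate, Finset.card_univ, Fintype.card_fin]
      at this
  have hpne : ∀ i, p i ≠ i := fun i => by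
    rw [← Equiv.Perm.mem_support, hp, support_finRotate]
    exact Finset.mem_univ i
  set i₀ : Fin d := 0
  have hA : ContGL (weightedPerm φ p i₀) := contGL_weightedPerm hφ
  obtain ⟨L, hL⟩ := (hcon d hd _ hA).exists_const hf hmin hA
  have hLge : 7 / 8 * r ≤ L := by
    refine le_of_forall_pos_le_add fun δ hδ => ?_
    obtain ⟨K, hK⟩ := eventually_atTop.1 (Metric.tendstoUniformly_iff.1 hL δ hδ)
    set k := K + 1
    have hk0 : (0 : ℝ) < k := by positivity
    have hdk : (0 : ℝ) < (d * k : ℕ) := by push_cast; positivity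
    have h1 : ∀ x, ∑ l ∈ Finset.range k, φ (f^[d * l] x) ≤ (d * k : ℕ) * (L + δ) := fun x => by
      refine (sum_le_visitSum (p := p) (i₀ := i₀) (by omega) hpd hφ0 k x).trans ?_
      have h2 := Real.log_le_log (Real.exp_pos _)
        (exp_visitSum_le_norm_cocycle (f := f) (φ := φ) (p := p) (i₀ := i₀) (d * k) i₀ x)
      rw [Real.log_exp] at h2
      refine h2.trans ?_
      have := hK (d * k) (K.le_succ.trans (Nat.le_mul_of_pos_left _ (by omega))) x
      rw [Real.dist_eq, abs_lt] at this
      have h3 : Real.log ‖cocycle f (weightedPerm φ p i₀) (d * k) x‖ / (d * k : ℕ) ≤ L + δ := by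
        linarith
      rw [div_le_iff₀ hdk] at h3
      linarith
    have hFl : ∀ l, ∫ x in F, φ (f^[d * l] x) ∂μ = ∫ x in F, φ x ∂μ := fun l => by
      have h5 := ((hpre.iterate d).restrict_preimage hF)
      rw [hdF] at h5
      have h6 := h5.iterate l
      rw [← Function.iterate_mul] at h6
      exact integral_comp_of_measurePreserving h6 hφ
    have h3 := integral_mono (μ := μ.restrict F)
      (integrable_of_continuous _ (continuous_finsetSum _ fun l _ => hiter (d * l)))
      (integrable_const ((d * k : ℕ) * (L + δ))) h1
    rw [integral_finsetSum _ fun l _ => integrable_of_continuous _ (hiter (d * l))] at h3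
    simp only [hFl, Finset.sum_const, Finset.card_range, nsmul_eq_mul, integral_const,
      measureReal_restrict_apply_univ, hrF, smul_eq_mul] at h3
    have h4 : r * ((d * k : ℕ) * (L + δ)) = k * (L + δ) := by
      rw [hr]
      push_cast
      field_simp
    rw [h4] at h3
    linarith [le_of_mul_le_mul_left h3 hk0]
  -- for large times, exactly one column dominates
  obtain ⟨n, hn1, hn2, hn3⟩ := (hbirk.and ((Metric.tendstoUniformly_iff.1 hL (r / 8)
    (by positivity)).and (eventually_ge_atTop (4 * d)))).exists
  have hnr : 4 ≤ r * n := by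
    rw [hr, inv_mul_eq_div, le_div_iff₀ hd0]
    exact_mod_cast hn3
  have hn0 : (0 : ℝ) < n := by
    have : 0 < n := by omega
    exact_mod_cast this
  set S := visitSum f φ p i₀ n with hS
  have hpair : ∀ x i j, i ≠ j → S i x + S j x < 10 / 8 * r * n := fun x i j hij => by
    refine lt_of_le_of_lt ?_ (hn1 x)
    rw [← sum_visitSum (p := p) (i₀ := i₀), ← Finset.sum_pair (f := fun i => S i x) hij]
    exact Finset.sum_le_sum_of_subset_of_nonneg (Finset.subset_univ _)
      fun i _ _ => visitSum_nonneg hφ0 n i x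
  have hcover : ∀ x, ∃ i, 3 / 4 * r * n < S i x := fun x => by
    by_contra! h
    have h1 := Real.log_le_log (hA.norm_cocycle_pos n x) (norm_cocycle_weightedPerm_le n x h)
    rw [Real.log_exp] at h1
    have := hn2 x
    rw [Real.dist_eq, abs_lt] at this
    have h2 : 3 / 4 * r < Real.log ‖cocycle f (weightedPerm φ p i₀) n x‖ / n := by linarith
    rw [lt_div_iff₀ hn0] at h2
    linarith
  obtain ⟨x⟩ := (inferInstance : Nonempty X)
  obtain ⟨i, hi⟩ := hcover x
  have huniv : {y | 3 / 4 * r * n < S i y} = univ := by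
    refine eq_univ_of_pairwise_disjoint_cover (U := fun i => {y | 3 / 4 * r * n < S i y})
      (fun j => isOpen_lt continuous_const (continuous_visitSum hf hφ n j))
      (fun j k hjk => disjoint_left.2 fun y hj hk => ?_) hcover ⟨x, hi⟩
    have h1 : 3 / 4 * r * n < S j y := hj
    have h2 : 3 / 4 * r * n < S k y := hk
    nlinarith [hpair y j k hjk]
  have h1 : 3 / 4 * r * n < S i (f x) := huniv.superset (mem_univ (f x))
  have h2 := visitSum_le_visitSum_map (f := f) (p := p) (i₀ := i₀) hφ0 hφ1 n i x
  have h3 := hpair (f x) i (p i) (hpne i).symm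
  simp only [hS] at h1 h3
  linarith

/-- Theorem A: a uniquely ergodic minimal dynamical system on a non-degenerate connected
compact metric space which is either not totally uniquely ergodic (class (I)), or totally
uniquely ergodic but not topologically weakly mixing (class (II)), admits a non-uniform
continuous `GL(m,ℝ)`-cocycle for some `m ≥ 2`. -/
theorem exists_nonuniform_cocycle_of_class_I_or_II
    {X : Type*} [MetricSpace X] [CompactSpace X] [ConnectedSpace X] [Nontrivial X]
    [MeasurableSpace X] [BorelSpace X]
    (f : X → X) (hf : IsHomeomorph f) (hmin : MinimalSys f) (hue : UniquelyErgodic f)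
    (hclass : ¬ TotallyUniquelyErgodic f ∨
      (TotallyUniquelyErgodic f ∧ ¬ TopWeaklyMixing f)) :
    ∃ m : ℕ, 2 ≤ m ∧ ∃ A : X → Matrix (Fin m) (Fin m) ℝ,
      ContGL A ∧ ¬ IsUniformCocycle f A := by
  obtain ⟨μ, hμ, huniq⟩ := hue
  have hμu : UniquelyErgodicWith f μ := ⟨hμ, huniq⟩
  have hfm : Measurable f := hf.continuous.measurable
  have := hμ.1
  rcases hclass with h | ⟨-, h⟩
  · unfold TotallyUniquelyErgodic at h
    push Not at h
    obtain ⟨n, hn, hnu⟩ := h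
    obtain ⟨d, F, hd, hF, hdF, hμF⟩ := (hμu.ergodic hfm).exists_cyclic_set hf.surjective hn
      (not_ergodic_iterate_of_not_uniquelyErgodic hfm hμu hn hnu)
    exact exists_nonuniform_cocycle_of_cyclic_set hf.continuous hmin ⟨hfm, hμ.2⟩ hd hF hdF hμF
  · obtain ⟨g, hg, ⟨c, hc, hgc⟩, hne⟩ := exists_eigenfunction_of_not_topWeaklyMixing hf hmin hμu h
    obtain ⟨k, w, hk, hw, hsurj⟩ := exists_circle_factor hf hmin hg hc hgc hne
    exact ⟨2, le_rfl, exists_nonuniform_cocycle_of_circle_factor hf.continuous hmin hk hw hsurj⟩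
end
end

section
/- Let (X,f) be a uniquely ergodic dynamical system and suppose there exists a prime p such that Q_{f^p}^e(X) ≠ X. Then for every m ≥ p there exists a non-uniform A ∈ C(X, GL(m,ℝ)). -/
open MeasureTheory Filter Topology Set
open scoped ENNReal NNReal

attribute [local instance] Matrix.normedAddCommGroup

noncomputable section

/-- The `(n+1)`-th empirical measure `E_{f,n+1}(x) = (1/(n+1)) ∑_{i=0}^{n} δ_{f^i x}`,
as a Borel probability measure. -/
def empPM {X : Type*} [TopologicalSpace X] [MeasurableSpace X]
    (f : X → X) (x : X) (n : ℕ) : ProbabilityMeasure X :=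
  ⟨((n + 1 : ℕ) : ℝ≥0∞)⁻¹ • ∑ i ∈ Finset.range (n + 1), Measure.dirac (f^[i] x), by
    constructor
    simp [Measure.smul_apply, Measure.coe_finset_sum, Finset.sum_apply]
    rw [ENNReal.inv_mul_cancel] <;> simp⟩

/-- `V_f(x)`: the set of weak* accumulation points of the empirical measures of `x`. -/
def VSet {X : Type*} [TopologicalSpace X] [MeasurableSpace X] [OpensMeasurableSpace X]
    (f : X → X) (x : X) : Set (ProbabilityMeasure X) :=
  {ν | MapClusterPt ν atTop (empPM f x)}

/-- `G_{f,μ}`: the set of generic points of `μ` for `f`. -/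
def genericPts {X : Type*} [TopologicalSpace X] [MeasurableSpace X] [OpensMeasurableSpace X]
    (f : X → X) (μ : ProbabilityMeasure X) : Set X :=
  {x | VSet f x = {μ}}

/-- `Q_f^e(X)`: the union of the sets of generic points over all `f`-ergodic
Borel probability measures. -/
def QeSet {X : Type*} [TopologicalSpace X] [MeasurableSpace X] [OpensMeasurableSpace X]
    (f : X → X) : Set X :=
  ⋃ μ ∈ {μ : ProbabilityMeasure X | Ergodic f μ.toMeasure}, genericPts f μ

section Topology

lemma MapClusterPt.eq_of_tendsto {ι Y : Type*} [TopologicalSpace Y] [T2Space Y] {F : Filter ι}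
    {u : ι → Y} {a b : Y} (ha : MapClusterPt a F u) (hb : Tendsto u F (𝓝 b)) : a = b :=
  haveI : (𝓝 a ⊓ 𝓝 b).NeBot := NeBot.mono ha (inf_le_inf_left _ hb)
  eq_of_nhds_neBot this

/-- A real sequence with vanishing increments accumulates at every value between two of its
accumulation points. -/
lemma mapClusterPt_of_lt_of_lt {a : ℕ → ℝ} (h : Tendsto (fun n => a (n + 1) - a n) atTop (𝓝 0))
    {s t c : ℝ} (hs : MapClusterPt s atTop a) (ht : MapClusterPt t atTop a)
    (hsc : s < c) (hct : c < t) : MapClusterPt c atTop a := by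
  rw [Metric.nhds_basis_ball.mapClusterPt_iff_frequently]
  intro ε hε
  rw [frequently_atTop]
  intro N
  obtain ⟨N₁, hN₁⟩ := eventually_atTop.1 (Metric.tendsto_nhds.1 h ε hε)
  obtain ⟨n, hn, hna⟩ := frequently_atTop.1 (hs.frequently (gt_mem_nhds hsc)) (max N N₁)
  obtain ⟨k, hk, hka⟩ := frequently_atTop.1 (ht.frequently (lt_mem_nhds hct)) n
  have hex : ∃ l, c < a (n + l) := ⟨k - n, by rwa [Nat.add_sub_cancel' hk]⟩
  classical
  have hl := Nat.find_spec hex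
  have hmin := fun {j} => Nat.find_min hex (m := j)
  generalize Nat.find hex = l at hl hmin
  obtain _ | l := l
  · exact absurd hl (not_lt.2 hna.le)
  · have h1 := not_lt.1 (hmin l.lt_succ_self)
    have h2 := hN₁ (n + l) (by omega)
    refine ⟨n + l, by omega, ?_⟩
    rw [Real.dist_eq, sub_zero, abs_lt] at h2
    rw [Metric.mem_ball, Real.dist_eq, abs_lt]
    rw [← add_assoc] at hl
    constructor <;> linarith [h2.1, h2.2]

/-- An accumulation point of the image of a sequence in a compact space is the image of an
accumulation point. -/
lemma MapClusterPt.exists_of_comp {ι Y Z : Type*} [TopologicalSpace Y] [CompactSpace Y]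
    [TopologicalSpace Z] [T2Space Z] {F : Filter ι} {u : ι → Y} {g : Y → Z} (hg : Continuous g)
    {c : Z} (hc : MapClusterPt c F (g ∘ u)) : ∃ y, MapClusterPt y F u ∧ g y = c := by
  have hne : (F ⊓ comap (g ∘ u) (𝓝 c)).NeBot := by
    rw [← map_neBot_iff (g ∘ u), Filter.push_pull, inf_comm]
    exact hc
  obtain ⟨y, hy⟩ := exists_clusterPt_of_compactSpace (map u (F ⊓ comap (g ∘ u) (𝓝 c)))
  have hy' : MapClusterPt y (F ⊓ comap (g ∘ u) (𝓝 c)) u := hy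
  refine ⟨y, hy'.mono inf_le_left, ?_⟩
  exact (hy'.continuousAt_comp hg.continuousAt).eq_of_tendsto
    (tendsto_comap.mono_left inf_le_right)

end Topology

section Empirical

lemma measure_eq_of_forall_integral_continuousMap_eq {X : Type*} [MetricSpace X]
    [MeasurableSpace X] [BorelSpace X] {μ ν : Measure X} [IsFiniteMeasure μ]
    [IsFiniteMeasure ν] (h : ∀ φ : C(X, ℝ), ∫ x, φ x ∂μ = ∫ x, φ x ∂ν) : μ = ν :=
  ext_of_forall_integral_eq_of_IsFiniteMeasure fun φ => h φ.toContinuousMap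

lemma ContinuousMap.exists_forall_abs_le {X : Type*} [TopologicalSpace X] [CompactSpace X]
    (φ : C(X, ℝ)) : ∃ C, 0 ≤ C ∧ ∀ x, |φ x| ≤ C :=
  ⟨‖φ‖, norm_nonneg _, fun x => φ.norm_coe_le_norm x⟩

variable {X : Type*} [MetricSpace X] [CompactSpace X] [MeasurableSpace X] [BorelSpace X]

lemma ContinuousMap.integrable_of_isFiniteMeasure (φ : C(X, ℝ)) (μ : Measure X)
    [IsFiniteMeasure μ] : Integrable φ μ :=
  (BoundedContinuousFunction.mkOfCompact φ).integrable μ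

lemma integral_empPM (g : X → X) (x : X) (n : ℕ) (φ : C(X, ℝ)) :
    ∫ y, φ y ∂(empPM g x n : Measure X)
      = (∑ i ∈ Finset.range (n + 1), φ (g^[i] x)) / (n + 1 : ℕ) := by
  have : (empPM g x n : Measure X) =
    ((n + 1 : ℕ) : ℝ≥0∞)⁻¹ • ∑ i ∈ Finset.range (n + 1), Measure.dirac (g^[i] x) := rfl
  rw [this, integral_smul_measure, integral_finsetSum_measure]
  · simp only [integral_dirac, ENNReal.toReal_inv, ENNReal.toReal_natCast, smul_eq_mul]
    rw [div_eq_inv_mul]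
  · intro i _
    exact φ.integrable_of_isFiniteMeasure _

lemma VSet_nonempty (g : X → X) (x : X) : (VSet g x).Nonempty :=
  exists_clusterPt_of_compactSpace (map (empPM g x) atTop)

lemma tendsto_const_div_succ_of_abs_le {b : ℕ → ℝ} {C : ℝ} (hb : ∀ n, |b n| ≤ C) :
    Tendsto (fun n => b n / (n + 1 : ℕ)) atTop (𝓝 0) := by
  refine squeeze_zero_norm (a := fun n : ℕ => C / (n + 1 : ℕ)) (fun n => ?_) ?_
  · rw [norm_div, Real.norm_eq_abs, Real.norm_natCast]
    gcongr
    exact hb n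
  · exact (tendsto_const_div_atTop_nhds_zero_nat C).comp (tendsto_add_atTop_nat 1)

lemma map_eq_of_mem_VSet {g : X → X} (hg : Continuous g) {x : X} {ν : ProbabilityMeasure X}
    (hν : ν ∈ VSet g x) : (ν : Measure X).map g = ν := by
  have : IsProbabilityMeasure ((ν : Measure X).map g) :=
    Measure.isProbabilityMeasure_map hg.aemeasurable
  refine measure_eq_of_forall_integral_continuousMap_eq fun φ => ?_
  rw [integral_map hg.aemeasurable φ.continuous.aestronglyMeasurable]
  have hc : Continuous fun κ : ProbabilityMeasure X =>
      ∫ y, (φ.comp ⟨g, hg⟩) y ∂(κ : Measure X) - ∫ y, φ y ∂(κ : Measure X) :=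
    (ProbabilityMeasure.continuous_integral_continuousMap _).sub
      (ProbabilityMeasure.continuous_integral_continuousMap _)
  have h1 := MapClusterPt.continuousAt_comp hc.continuousAt hν
  obtain ⟨C, -, hC⟩ := φ.exists_forall_abs_le
  have h2 : Tendsto ((fun κ : ProbabilityMeasure X =>
      ∫ y, (φ.comp ⟨g, hg⟩) y ∂(κ : Measure X) - ∫ y, φ y ∂(κ : Measure X)) ∘ empPM g x)
      atTop (𝓝 0) := by
    refine (tendsto_const_div_succ_of_abs_le
      (b := fun n => φ (g^[n + 1] x) - φ x) (C := C + C) fun n => ?_).congr fun n => ?_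
    · exact (abs_sub _ _).trans (add_le_add (hC _) (hC _))
    · simp only [Function.comp, integral_empPM]
      rw [← sub_div]
      simp only [ContinuousMap.comp_apply, ContinuousMap.coe_mk]
      rw [← Finset.sum_sub_distrib]
      have := Finset.sum_range_sub (fun i => φ (g^[i] x)) (n + 1)
      simp only [Function.iterate_succ_apply'] at this ⊢
      rw [this]
      rfl
  exact sub_eq_zero.1 (h1.eq_of_tendsto h2)

lemma UniquelyErgodic.exists_eq_const {f : X → X} (hue : UniquelyErgodic f) (hf : Continuous f)
    (L : C(X, ℝ)) (hL : ∀ x, L (f x) = L x) : ∃ M, ∀ x, L x = M := by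
  obtain ⟨μ, -, hμ⟩ := hue
  refine ⟨∫ y, L y ∂μ, fun x => ?_⟩
  obtain ⟨ν, hν⟩ := VSet_nonempty f x
  have hνμ := hμ ν ⟨inferInstance, map_eq_of_mem_VSet hf hν⟩
  have h1 := MapClusterPt.continuousAt_comp
    (ProbabilityMeasure.continuous_integral_continuousMap L).continuousAt hν
  have hit : ∀ n, L (f^[n] x) = L x := fun n => by
    induction n with
    | zero => rfl
    | succ n ih => rw [Function.iterate_succ_apply', hL, ih]
  have h2 : Tendsto ((fun κ : ProbabilityMeasure X => ∫ y, L y ∂(κ : Measure X)) ∘ empPM f x)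
      atTop (𝓝 (L x)) := by
    refine tendsto_const_nhds.congr fun n => ?_
    simp only [Function.comp, integral_empPM, hit]
    simp
    field_simp
  rw [← hνμ]
  exact (h1.eq_of_tendsto h2).symm

lemma tendsto_integral_empPM_succ_sub (g : X → X) (x : X) (φ : C(X, ℝ)) :
    Tendsto (fun n => ∫ y, φ y ∂(empPM g x (n + 1) : Measure X)
      - ∫ y, φ y ∂(empPM g x n : Measure X)) atTop (𝓝 0) := by
  obtain ⟨C, hC0, hC⟩ := φ.exists_forall_abs_le
  refine squeeze_zero_norm (a := fun n : ℕ => (2 * C) / (n + 1 : ℕ)) (fun n => ?_) ?_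
  · rw [integral_empPM, integral_empPM, Finset.sum_range_succ _ (n + 1)]
    set s := ∑ i ∈ Finset.range (n + 1), φ (g^[i] x) with hs
    have hsC : |s| ≤ (n + 1) * C := by
      refine (Finset.abs_sum_le_sum_abs _ _).trans ?_
      refine (Finset.sum_le_sum fun i _ => hC (g^[i] x)).trans ?_
      simp
    have key : (s + φ (g^[n + 1] x)) / ((n + 1 + 1 : ℕ) : ℝ) - s / ((n + 1 : ℕ) : ℝ)
        = (φ (g^[n + 1] x) - s / (n + 1)) / (n + 2) := by
      push_cast
      field_simp
      ring
    rw [key, norm_div, Real.norm_eq_abs, Real.norm_eq_abs,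
      abs_of_nonneg (by positivity : (0 : ℝ) ≤ n + 2)]
    have h3 : |s / ((n : ℝ) + 1)| ≤ C := by
      rw [abs_div, abs_of_nonneg (by positivity : (0 : ℝ) ≤ n + 1), div_le_iff₀ (by positivity)]
      linarith
    have h4 : |φ (g^[n + 1] x) - s / (n + 1)| ≤ 2 * C := by
      refine (abs_sub _ _).trans ?_
      linarith [hC (g^[n + 1] x)]
    push_cast
    gcongr
    linarith
  · exact (tendsto_const_div_atTop_nhds_zero_nat _).comp (tendsto_add_atTop_nat 1)

/-- Finitely many probability measures are separated by the integrals of a single nonnegative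
continuous function. -/
lemma exists_continuousMap_integral_injOn {ι : Type*} [Finite ι] (ν : ι → Measure X)
    [∀ i, IsProbabilityMeasure (ν i)] :
    ∃ φ : C(X, ℝ), (∀ x, 0 ≤ φ x) ∧ ∀ i j, ∫ x, φ x ∂(ν i) = ∫ x, φ x ∂(ν j) → ν i = ν j := by
  let D (q : {q : ι × ι // ν q.1 ≠ ν q.2}) : Module.Dual ℝ C(X, ℝ) :=
    { toFun := fun φ => ∫ x, φ x ∂(ν q.1.1) - ∫ x, φ x ∂(ν q.1.2)
      map_add' := fun φ ψ => by
        simp only [ContinuousMap.add_apply]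
        rw [integral_add (φ.integrable_of_isFiniteMeasure _) (ψ.integrable_of_isFiniteMeasure _),
          integral_add (φ.integrable_of_isFiniteMeasure _) (ψ.integrable_of_isFiniteMeasure _)]
        ring
      map_smul' := fun c φ => by
        simp only [ContinuousMap.smul_apply, integral_smul, RingHom.id_apply, smul_sub] }
  obtain ⟨φ, hφ⟩ := Module.Dual.exists_forall_ne_zero_of_forall_exists D fun q => by
    by_contra! h
    exact q.2 (measure_eq_of_forall_integral_continuousMap_eq fun φ => sub_eq_zero.1 (h φ))
  obtain ⟨C, -, hC⟩ := φ.exists_forall_abs_le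
  refine ⟨φ + ContinuousMap.const X C, fun x => ?_, fun i j hij => ?_⟩
  · have := (abs_le.1 (hC x)).1
    simp only [ContinuousMap.add_apply, ContinuousMap.const_apply]
    linarith
  · by_contra hne
    refine hφ ⟨(i, j), hne⟩ ?_
    simp only [ContinuousMap.add_apply, ContinuousMap.const_apply] at hij
    rw [integral_add (φ.integrable_of_isFiniteMeasure _) (integrable_const _),
      integral_add (φ.integrable_of_isFiniteMeasure _) (integrable_const _)] at hij
    simp only [integral_const, probReal_univ, one_smul, add_left_inj] at hij
    exact sub_eq_zero.2 hij

end Empirical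

section GeneralizedPermutation

/-- The generalized permutation matrix with entry `exp (w b)` at `(σ b, b)` and zeros elsewhere. -/
def expPermMatrix {m : ℕ} (σ : Fin m → Fin m) (w : Fin m → ℝ) : Matrix (Fin m) (Fin m) ℝ :=
  Matrix.of fun a b => if a = σ b then Real.exp (w b) else 0

lemma isUnit_expPermMatrix {m : ℕ} (σ : Equiv.Perm (Fin m)) (w : Fin m → ℝ) :
    IsUnit (expPermMatrix σ w) := by
  refine (Matrix.isUnit_iff_isUnit_det _).2 (Matrix.isUnit_det_of_right_inverse
    (B := expPermMatrix σ.symm fun a => -w (σ.symm a)) ?_)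
  ext a b
  rw [Matrix.mul_apply, Finset.sum_eq_single (σ.symm b)]
  · by_cases hab : a = b
    · simp [expPermMatrix, hab, ← Real.exp_add, Matrix.one_apply]
    · simp [expPermMatrix, hab]
  · intro c _ hc
    simp [expPermMatrix, hc]
  · simp

lemma cocycle_expPermMatrix {X : Type*} {m : ℕ} (f : X → X) (σ : Fin m → Fin m)
    (w : X → Fin m → ℝ) (n : ℕ) (x : X) :
    cocycle f (fun y => expPermMatrix σ (w y)) n x
      = expPermMatrix σ^[n] fun b => ∑ k ∈ Finset.range n, w (f^[k] x) (σ^[k] b) := by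
  induction n with
  | zero =>
    ext a b
    simp [cocycle, expPermMatrix, Matrix.one_apply]
  | succ n ih =>
    ext a b
    rw [cocycle, ih, Matrix.mul_apply, Finset.sum_eq_single (σ^[n] b)]
    · by_cases ha : a = σ (σ^[n] b)
      · simp [expPermMatrix, ha, ← Real.exp_add, Finset.sum_range_succ,
          Function.iterate_succ_apply', add_comm]
      · simp [expPermMatrix, ha, Function.iterate_succ_apply']
    · intro c _ hc
      simp [expPermMatrix, hc]
    · simp

/-- The permutation of `Fin m` that rotates the first `p` elements. -/
lemma exists_perm_rotating_initial_segment {p m : ℕ} (hp : p ≠ 0) (hm : p ≤ m) :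
    ∃ σ : Equiv.Perm (Fin m), ∀ b : Fin m, (σ b : ℕ) = if (b : ℕ) < p then (b + 1) % p else b := by
  obtain ⟨m, rfl⟩ : ∃ k, m = k + 1 := ⟨m - 1, by omega⟩
  refine ⟨Fin.cycleRange ⟨p - 1, by omega⟩, fun b => ?_⟩
  rcases lt_trichotomy (b : ℕ) (p - 1) with h | h | h
  · rw [Fin.coe_cycleRange_of_lt (Fin.lt_def.2 h), if_pos (by omega), Nat.mod_eq_of_lt (by omega)]
  · rw [Fin.cycleRange_of_eq (Fin.ext h), if_pos (by omega), h, Nat.sub_add_cancel (by omega)]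
    simp
  · rw [Fin.cycleRange_of_gt (Fin.lt_def.2 h), if_neg (by omega)]

lemma iterate_rotation_val {p m : ℕ} {σ : Fin m → Fin m}
    (hσ : ∀ b : Fin m, (σ b : ℕ) = if (b : ℕ) < p then (b + 1) % p else b) (b : Fin m) (k : ℕ) :
    (σ^[k] b : ℕ) = if (b : ℕ) < p then (b + k) % p else b := by
  induction k with
  | zero =>
    split_ifs with hb
    · simp [Nat.mod_eq_of_lt hb]
    · rfl
  | succ k ih =>
    rw [Function.iterate_succ_apply', hσ, ih]
    by_cases hb : (b : ℕ) < p
    · rw [if_pos hb, if_pos hb, if_pos (Nat.mod_lt _ (by omega)), Nat.mod_add_mod, add_assoc]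
    · simp only [if_neg hb]

lemma add_mod_eq_zero_iff {p b : ℕ} (hb : b < p) (k : ℕ) :
    (b + k) % p = 0 ↔ k % p = (p - b) % p := by
  have hk : k % p < p := Nat.mod_lt _ (by omega)
  rw [← Nat.add_mod_mod]
  generalize k % p = r at hk
  rcases Nat.eq_zero_or_pos b with rfl | hb0
  · simp [Nat.mod_eq_of_lt hk]
  · rw [Nat.mod_eq_of_lt (show p - b < p by omega)]
    rcases lt_or_ge (b + r) p with h | h
    · rw [Nat.mod_eq_of_lt h]
      omega
    · rw [Nat.mod_eq_sub_mod h, Nat.mod_eq_of_lt (by omega)]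
      omega

lemma sum_range_mul_ite_mod_eq (g : ℕ → ℝ) {p i : ℕ} (hi : i < p) (N : ℕ) :
    ∑ k ∈ Finset.range (p * N), (if k % p = i then g k else 0)
      = ∑ j ∈ Finset.range N, g (p * j + i) := by
  induction N with
  | zero => simp
  | succ N ih =>
    rw [Nat.mul_succ, Finset.sum_range_add, ih, Finset.sum_range_succ]
    congr 1
    rw [Finset.sum_eq_single i]
    · simp [Nat.mod_eq_of_lt hi]
    · intro k hk hki
      simp [Nat.mod_eq_of_lt (Finset.mem_range.1 hk), hki]
    · simp [hi]

end GeneralizedPermutation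

section BlockSums

/-- The Birkhoff sum of `φ` over the first `N` times congruent to `i` modulo `p`. -/
def blockSum {X : Type*} (f : X → X) (p : ℕ) (φ : X → ℝ) (i N : ℕ) (x : X) : ℝ :=
  ∑ j ∈ Finset.range N, φ (f^[p * j + i] x)

/-- The largest of the sums `blockSum f p φ i N x` over the residues `i` modulo `p`. -/
def maxBlockSum {X : Type*} (f : X → X) {p : ℕ} (hp : p ≠ 0) (φ : X → ℝ) (N : ℕ) (x : X) : ℝ :=
  (Finset.range p).sup' (Finset.nonempty_range_iff.2 hp) fun i => blockSum f p φ i N x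

variable {X : Type*} {f : X → X} {p : ℕ} {φ : X → ℝ}

lemma blockSum_le_maxBlockSum (hp : p ≠ 0) {i : ℕ} (hi : i < p) (N : ℕ) (x : X) :
    blockSum f p φ i N x ≤ maxBlockSum f hp φ N x :=
  Finset.le_sup' (fun i => blockSum f p φ i N x) (Finset.mem_range.2 hi)

lemma blockSum_succ_index (i N : ℕ) (x : X) :
    blockSum f p φ (i + 1) N x = blockSum f p φ i N (f x) := by
  simp only [blockSum, ← add_assoc, Function.iterate_succ_apply]

lemma blockSum_self_index (N : ℕ) (x : X) :
    blockSum f p φ p N x = blockSum f p φ 0 N x + (φ (f^[p * N] x) - φ x) := by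
  have h := Finset.sum_range_sub (fun j => φ (f^[p * j] x)) N
  rw [Finset.sum_sub_distrib] at h
  simp only [Nat.mul_succ, Nat.mul_zero, Function.iterate_zero, id] at h
  simp only [blockSum, add_zero]
  linarith

lemma abs_maxBlockSum_comp_sub_le (hp : p ≠ 0) {C : ℝ} (hC : ∀ x, |φ x| ≤ C) (N : ℕ) (x : X) :
    |maxBlockSum f hp φ N (f x) - maxBlockSum f hp φ N x| ≤ 2 * C := by
  have hb : ∀ y, -C ≤ φ y ∧ φ y ≤ C := fun y => abs_le.1 (hC y)
  have hC0 : 0 ≤ C := (abs_nonneg _).trans (hC x)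
  have h1 := hb (f^[p * N] x)
  have h2 := hb x
  have hself := blockSum_self_index (f := f) (p := p) (φ := φ) N x
  rw [abs_le]
  constructor
  · rw [neg_le_sub_iff_le_add]
    refine Finset.sup'_le _ _ fun i hi => ?_
    rw [Finset.mem_range] at hi
    rcases i with _ | i
    · have h3 := blockSum_le_maxBlockSum (f := f) (φ := φ) hp (show p - 1 < p by omega) N (f x)
      rw [← blockSum_succ_index, Nat.sub_add_cancel (by omega)] at h3
      linarith
    · rw [blockSum_succ_index]
      linarith [blockSum_le_maxBlockSum (f := f) (φ := φ) hp (show i < p by omega) N (f x)]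
  · rw [sub_le_iff_le_add]
    refine Finset.sup'_le _ _ fun i hi => ?_
    rw [Finset.mem_range] at hi
    rw [← blockSum_succ_index]
    rcases Nat.lt_or_ge (i + 1) p with h | h
    · linarith [blockSum_le_maxBlockSum (f := f) (φ := φ) hp h N x]
    · obtain rfl : i + 1 = p := by omega
      linarith [blockSum_le_maxBlockSum (f := f) (φ := φ) hp (Nat.succ_pos i) N x]

lemma log_norm_cocycle_expPermMatrix {m : ℕ} (hp : p ≠ 0) (hm : p ≤ m) (hφ : ∀ x, 0 ≤ φ x)
    {σ : Fin m → Fin m}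
    (hσ : ∀ b : Fin m, (σ b : ℕ) = if (b : ℕ) < p then (b + 1) % p else b) (N : ℕ) (x : X) :
    Real.log ‖cocycle f (fun y => expPermMatrix σ fun b => if (b : ℕ) = 0 then φ y else 0)
      (p * N) x‖ = maxBlockSum f hp φ N x := by
  have hp0 : 0 < p := Nat.pos_of_ne_zero hp
  rw [cocycle_expPermMatrix]
  set W : Fin m → ℝ := fun b =>
    ∑ k ∈ Finset.range (p * N), if (σ^[k] b : ℕ) = 0 then φ (f^[k] x) else 0 with hW
  have hlt : ∀ b : Fin m, (b : ℕ) < p → W b = blockSum f p φ ((p - b) % p) N x := fun b hb => by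
    simp only [hW, iterate_rotation_val hσ, if_pos hb, add_mod_eq_zero_iff hb]
    exact sum_range_mul_ite_mod_eq (fun k => φ (f^[k] x)) (Nat.mod_lt _ hp0) N
  have hge : ∀ b : Fin m, ¬ (b : ℕ) < p → W b = 0 := fun b hb => by
    simp only [hW, iterate_rotation_val hσ, if_neg hb, if_neg (show ¬ (b : ℕ) = 0 by omega)]
    simp
  have hmax0 : 0 ≤ maxBlockSum f hp φ N x :=
    (Finset.sum_nonneg fun j _ => hφ _).trans (blockSum_le_maxBlockSum hp hp0 N x)
  have hnorm : ‖expPermMatrix σ^[p * N] W‖ = Real.exp (maxBlockSum f hp φ N x) := by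
    refine le_antisymm ((Matrix.norm_le_iff (Real.exp_pos _).le).2 fun a b => ?_) ?_
    · simp only [expPermMatrix, Matrix.of_apply]
      split_ifs with hab
      · rw [Real.norm_eq_abs, Real.abs_exp, Real.exp_le_exp]
        by_cases hb : (b : ℕ) < p
        · rw [hlt b hb]
          exact blockSum_le_maxBlockSum hp (Nat.mod_lt _ hp0) N x
        · rwa [hge b hb]
      · simpa using (Real.exp_pos _).le
    · obtain ⟨i, hi, hmax⟩ := Finset.exists_mem_eq_sup' (Finset.nonempty_range_iff.2 hp)
        fun i => blockSum f p φ i N x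
      rw [Finset.mem_range] at hi
      let b : Fin m := ⟨(p - i) % p, (Nat.mod_lt _ hp0).trans_le hm⟩
      have hb : (b : ℕ) < p := Nat.mod_lt _ hp0
      have hbi : (p - b) % p = i := by
        rcases Nat.eq_zero_or_pos i with rfl | hi0
        · simp [b]
        · have : (b : ℕ) = p - i := Nat.mod_eq_of_lt (by omega)
          rw [this, Nat.mod_eq_of_lt] <;> omega
      have hentry := Matrix.norm_entry_le_entrywise_sup_norm (expPermMatrix σ^[p * N] W)
        (i := σ^[p * N] b) (j := b)
      rw [expPermMatrix, Matrix.of_apply, if_pos rfl, Real.norm_eq_abs, Real.abs_exp, hlt b hb, hbi]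
        at hentry
      rw [maxBlockSum, hmax]
      exact hentry
  rw [hnorm, Real.log_exp]

end BlockSums

section MaximalMeasures

lemma Continuous.maxBlockSum {X : Type*} [TopologicalSpace X] {f : X → X} {p : ℕ}
    (hf : Continuous f) (hp : p ≠ 0) {φ : X → ℝ} (hφ : Continuous φ) (N : ℕ) :
    Continuous (maxBlockSum f hp φ N) :=
  Continuous.finset_sup'_apply _ fun _ _ =>
    continuous_finsetSum _ fun _ _ => hφ.comp (hf.iterate _)

lemma map_iterate_map_iterate_sub {X : Type*} [MeasurableSpace X] {f : X → X} {p : ℕ}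
    (hf : Measurable f) {κ : Measure X} (hκ : MeasurePreserving f^[p] κ κ) {i : ℕ} (hi : i ≤ p) :
    (κ.map f^[i]).map f^[p - i] = κ := by
  rw [Measure.map_map (hf.iterate _) (hf.iterate _), ← Function.iterate_add,
    Nat.sub_add_cancel hi, hκ.map_eq]

variable {X : Type*} [MetricSpace X] [CompactSpace X] [MeasurableSpace X] [BorelSpace X]
  {f : X → X} {p : ℕ}

/-- If all `GL(m, ℝ)`-valued cocycles over a uniquely ergodic map are uniform, then the averaged
maximal block sums of a nonnegative continuous function converge uniformly to a constant. -/
lemma exists_tendstoUniformly_maxBlockSum (hf : Continuous f) (hue : UniquelyErgodic f)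
    (hp : p ≠ 0) {m : ℕ} (hm : p ≤ m)
    (hA : ∀ A : X → Matrix (Fin m) (Fin m) ℝ, ContGL A → IsUniformCocycle f A)
    (φ : C(X, ℝ)) (hφ : ∀ x, 0 ≤ φ x) :
    ∃ M : ℝ, TendstoUniformly (fun (N : ℕ) x => maxBlockSum f hp φ N x / N) (fun _ => M) atTop := by
  obtain ⟨σ, hσ⟩ := exists_perm_rotating_initial_segment hp hm
  obtain ⟨L, hL⟩ := hA (fun y => expPermMatrix σ fun b => if (b : ℕ) = 0 then φ y else 0) <| by
    refine ⟨continuous_matrix fun a b => ?_, fun x => isUnit_expPermMatrix σ _⟩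
    simp only [expPermMatrix, Matrix.of_apply]
    split_ifs <;> fun_prop
  have hp0 : (0 : ℝ) < p := Nat.cast_pos.2 (Nat.pos_of_ne_zero hp)
  have hU : TendstoUniformly (fun (N : ℕ) x => maxBlockSum f hp φ N x / N)
      (fun x => p * L x) atTop := by
    rw [Metric.tendstoUniformly_iff] at hL ⊢
    intro ε hε
    have hmul : Tendsto (fun N => p * N) atTop atTop :=
      tendsto_id.const_mul_atTop' (Nat.pos_of_ne_zero hp)
    filter_upwards [hmul.eventually (hL (ε / p) (by positivity))] with N hN x
    have h := hN x
    rw [log_norm_cocycle_expPermMatrix hp hm hφ hσ, Real.dist_eq, lt_div_iff₀ hp0] at h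
    rw [Real.dist_eq]
    refine lt_of_eq_of_lt ?_ h
    rw [← abs_of_pos hp0, ← abs_mul, abs_of_pos hp0]
    congr 1
    push_cast
    rcases eq_or_ne (N : ℝ) 0 with h0 | h0
    · simp [h0, mul_comm]
    · field_simp
  have hLc : Continuous fun x => p * L x :=
    hU.continuous (Frequently.of_forall fun N =>
      (Continuous.maxBlockSum hf hp φ.continuous N).div_const _)
  obtain ⟨C, -, hC⟩ := φ.exists_forall_abs_le
  have hinv : ∀ x, p * L (f x) = p * L x := fun x => by
    have h1 := (hU.tendsto_at (f x)).sub (hU.tendsto_at x)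
    have h2 : Tendsto (fun N : ℕ =>
        maxBlockSum f hp φ N (f x) / N - maxBlockSum f hp φ N x / N) atTop (𝓝 0) := by
      refine squeeze_zero_norm (a := fun N : ℕ => 2 * C / N) (fun N => ?_)
        (tendsto_const_div_atTop_nhds_zero_nat _)
      rw [← sub_div, norm_div, Real.norm_eq_abs, Real.norm_natCast]
      gcongr
      exact abs_maxBlockSum_comp_sub_le hp hC N x
    exact sub_eq_zero.1 (tendsto_nhds_unique h1 h2)
  obtain ⟨M, hM⟩ := hue.exists_eq_const hf ⟨_, hLc⟩ hinv
  refine ⟨M, ?_⟩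
  rwa [show (fun x => p * L x) = fun _ => M from funext hM] at hU

lemma integral_comp_iterate_le (hf : Continuous f) (hp : p ≠ 0) {φ : C(X, ℝ)} {M : ℝ}
    (hM : TendstoUniformly (fun (N : ℕ) x => maxBlockSum f hp φ N x / N) (fun _ => M) atTop)
    {κ : Measure X} [IsProbabilityMeasure κ] (hκ : MeasurePreserving f^[p] κ κ)
    {i : ℕ} (hi : i < p) : ∫ y, φ (f^[i] y) ∂κ ≤ M := by
  have hinteg : ∀ k, Integrable (fun y => φ (f^[k] y)) κ := fun k =>
    (φ.comp ⟨_, hf.iterate k⟩).integrable_of_isFiniteMeasure κ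
  refine le_of_forall_pos_le_add fun ε hε => ?_
  obtain ⟨N, hN, hN0⟩ :=
    ((Metric.tendstoUniformly_iff.1 hM ε hε).and (eventually_gt_atTop 0)).exists
  have hN0' : (0 : ℝ) < N := Nat.cast_pos.2 hN0
  have hj : ∀ j, ∫ y, φ (f^[p * j + i] y) ∂κ = ∫ y, φ (f^[i] y) ∂κ := fun j => by
    have hpres := hκ.iterate j
    rw [← Function.iterate_mul] at hpres
    conv_rhs => rw [← hpres.map_eq]
    rw [integral_map (f := fun y => φ (f^[i] y)) hpres.aemeasurable
      (φ.continuous.comp (hf.iterate i)).aestronglyMeasurable]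
    simp only [← Function.iterate_add_apply, add_comm i]
  have hsum : ∫ y, blockSum f p φ i N y ∂κ = N * ∫ y, φ (f^[i] y) ∂κ := by
    simp only [blockSum]
    rw [integral_finsetSum _ fun j _ => hinteg _]
    simp [hj]
  have hle : ∫ y, blockSum f p φ i N y ∂κ ≤ ∫ _, N * (M + ε) ∂κ := by
    refine integral_mono (integrable_finsetSum _ fun j _ => hinteg _) (integrable_const _)
      fun y => ?_
    refine (blockSum_le_maxBlockSum hp hi N y).trans ?_
    have h := (abs_lt.1 (Real.dist_eq _ _ ▸ hN y)).1
    rw [mul_comm, ← div_le_iff₀ hN0']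
    linarith
  rw [hsum, integral_const, probReal_univ, one_smul] at hle
  exact le_of_mul_le_mul_left hle hN0'

lemma exists_integral_comp_iterate_eq (hf : Continuous f) (hp : p ≠ 0) {φ : C(X, ℝ)} {M : ℝ}
    (hM : TendstoUniformly (fun (N : ℕ) x => maxBlockSum f hp φ N x / N) (fun _ => M) atTop)
    {x : X} {κ : ProbabilityMeasure X} (hκ : κ ∈ VSet f^[p] x) :
    ∃ i < p, ∫ y, φ (f^[i] y) ∂(κ : Measure X) = M := by
  have hne := Finset.nonempty_range_iff.2 hp
  let G : ProbabilityMeasure X → ℝ := fun κ =>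
    (Finset.range p).sup' hne fun i => ∫ y, φ (f^[i] y) ∂(κ : Measure X)
  have hG : Continuous G := Continuous.finset_sup'_apply _ fun i _ =>
    ProbabilityMeasure.continuous_integral_continuousMap (φ.comp ⟨_, hf.iterate i⟩)
  have hlim : Tendsto (G ∘ empPM f^[p] x) atTop (𝓝 M) := by
    refine ((hM.tendsto_at x).comp (tendsto_add_atTop_nat 1)).congr fun n => ?_
    have hpos : (0 : ℝ) < (n + 1 : ℕ) := Nat.cast_pos.2 n.succ_pos
    simp only [Function.comp, G]
    have hemp : ∀ i, ∫ y, φ (f^[i] y) ∂(empPM f^[p] x n : Measure X)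
        = blockSum f p φ i (n + 1) x / (n + 1 : ℕ) := fun i => by
      refine (integral_empPM f^[p] x n (φ.comp ⟨_, hf.iterate i⟩)).trans ?_
      simp only [blockSum, ContinuousMap.comp_apply, ContinuousMap.coe_mk, ← Function.iterate_mul,
        ← Function.iterate_add_apply, add_comm i]
    simp only [hemp, maxBlockSum]
    exact Finset.apply_sup'_eq_sup'_comp hne (fun r : ℝ => r / (n + 1 : ℕ)) fun a b =>
      (max_div_div_right hpos.le a b).symm
  have hGM : G κ = M := (MapClusterPt.continuousAt_comp hG.continuousAt hκ).eq_of_tendsto hlim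
  obtain ⟨i, hi, h⟩ := Finset.exists_mem_eq_sup' hne fun i => ∫ y, φ (f^[i] y) ∂(κ : Measure X)
  exact ⟨i, Finset.mem_range.1 hi, h.symm.trans hGM⟩

lemma measurePreserving_of_mem_VSet {g : X → X} (hg : Continuous g) {x : X}
    {κ : ProbabilityMeasure X} (hκ : κ ∈ VSet g x) :
    MeasurePreserving g (κ : Measure X) κ :=
  ⟨hg.measurable, map_eq_of_mem_VSet hg hκ⟩

lemma ergodic_of_mem_VSet (hf : Continuous f) (hp : p ≠ 0)
    (hM : ∀ φ : C(X, ℝ), (∀ x, 0 ≤ φ x) → ∃ M : ℝ,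
      TendstoUniformly (fun (N : ℕ) x => maxBlockSum f hp φ N x / N) (fun _ => M) atTop)
    {x : X} {κ : ProbabilityMeasure X} (hκ : κ ∈ VSet f^[p] x) :
    Ergodic f^[p] (κ : Measure X) := by
  have hκp := measurePreserving_of_mem_VSet (hf.iterate p) hκ
  rw [Ergodic.iff_mem_extremePoints, mem_extremePoints_iff_left]
  refine ⟨⟨hκp, inferInstance⟩, ?_⟩
  rintro κ₁ ⟨hκ₁, hprob₁⟩ κ₂ ⟨hκ₂, hprob₂⟩ ⟨a, b, ha, hb, hab, hsum⟩
  have hprob : ∀ (i : ℕ) (ν : Measure X) [IsProbabilityMeasure ν],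
      IsProbabilityMeasure (ν.map f^[i]) := fun i ν _ =>
    Measure.isProbabilityMeasure_map (hf.iterate i).aemeasurable
  let ν : Bool × Fin p → Measure X := fun q => (if q.1 then κ₁ else κ).map f^[q.2]
  have hν : ∀ q, IsProbabilityMeasure (ν q) := by
    rintro ⟨_ | _, i⟩
    · exact hprob i κ
    · exact hprob i κ₁
  obtain ⟨φ, hφ0, hφ⟩ := exists_continuousMap_integral_injOn ν
  obtain ⟨M, hφM⟩ := hM φ hφ0
  obtain ⟨i, hi, hiM⟩ := exists_integral_comp_iterate_eq hf hp hφM hκ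
  have h1 := integral_comp_iterate_le hf hp hφM hκ₁ hi
  have h2 := integral_comp_iterate_le hf hp hφM hκ₂ hi
  have ha1 : a ≠ ∞ := ((self_le_add_right a b).trans_lt (hab ▸ ENNReal.one_lt_top)).ne
  have hb1 : b ≠ ∞ := ((self_le_add_left b a).trans_lt (hab ▸ ENNReal.one_lt_top)).ne
  have hinteg : ∀ (ν : Measure X) [IsProbabilityMeasure ν], Integrable (fun y => φ (f^[i] y)) ν :=
    fun ν _ => (φ.comp ⟨_, hf.iterate i⟩).integrable_of_isFiniteMeasure ν
  have hsplit := hiM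
  rw [← hsum, integral_add_measure ((hinteg κ₁).smul_measure ha1) ((hinteg κ₂).smul_measure hb1),
    integral_smul_measure, integral_smul_measure, smul_eq_mul, smul_eq_mul] at hsplit
  have hab' : a.toReal + b.toReal = 1 := by
    rw [← ENNReal.toReal_add ha1 hb1, hab, ENNReal.toReal_one]
  have ha0 : 0 < a.toReal := ENNReal.toReal_pos ha.ne' ha1
  have hb0 : 0 ≤ b.toReal := ENNReal.toReal_nonneg
  have h1M : ∫ y, φ (f^[i] y) ∂κ₁ = M := by
    refine le_antisymm h1 (le_of_mul_le_mul_left ?_ ha0)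
    have := mul_le_mul_of_nonneg_left h2 hb0
    have hM1 : a.toReal * M + b.toReal * M = M := by rw [← add_mul, hab', one_mul]
    linarith
  have heq := hφ (true, ⟨i, hi⟩) (false, ⟨i, hi⟩) <| by
    simp only [ν, if_true, Bool.false_eq_true, if_false]
    rw [integral_map (hf.iterate i).aemeasurable φ.continuous.aestronglyMeasurable,
      integral_map (hf.iterate i).aemeasurable φ.continuous.aestronglyMeasurable, h1M, hiM]
  simp only [ν, if_true, Bool.false_eq_true, if_false] at heq
  rw [← map_iterate_map_iterate_sub hf.measurable hκ₁ hi.le, heq,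
    map_iterate_map_iterate_sub hf.measurable hκp hi.le]

lemma exists_eq_map_map_of_mem_VSet (hf : Continuous f) (hp : p ≠ 0)
    (hM : ∀ φ : C(X, ℝ), (∀ x, 0 ≤ φ x) → ∃ M : ℝ,
      TendstoUniformly (fun (N : ℕ) x => maxBlockSum f hp φ N x / N) (fun _ => M) atTop)
    {x : X} {κ ν : ProbabilityMeasure X} (hκ : κ ∈ VSet f^[p] x) (hν : ν ∈ VSet f^[p] x) :
    ∃ i < p, ∃ j < p, (ν : Measure X) = ((κ : Measure X).map f^[i]).map f^[p - j] := by
  have hνp := measurePreserving_of_mem_VSet (hf.iterate p) hν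
  let η : Bool × Fin p → Measure X := fun q =>
    ((if q.1 then κ else ν : ProbabilityMeasure X) : Measure X).map f^[q.2]
  have hη : ∀ q, IsProbabilityMeasure (η q) := fun q =>
    Measure.isProbabilityMeasure_map (hf.iterate _).aemeasurable
  obtain ⟨φ, hφ0, hφ⟩ := exists_continuousMap_integral_injOn η
  obtain ⟨M, hφM⟩ := hM φ hφ0
  obtain ⟨i, hi, hiM⟩ := exists_integral_comp_iterate_eq hf hp hφM hκ
  obtain ⟨j, hj, hjM⟩ := exists_integral_comp_iterate_eq hf hp hφM hν
  have heq := hφ (true, ⟨i, hi⟩) (false, ⟨j, hj⟩) <| by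
    simp only [η, if_true, Bool.false_eq_true, if_false]
    rw [integral_map (hf.iterate i).aemeasurable φ.continuous.aestronglyMeasurable,
      integral_map (hf.iterate j).aemeasurable φ.continuous.aestronglyMeasurable, hiM, hjM]
  simp only [η, if_true, Bool.false_eq_true, if_false] at heq
  exact ⟨i, hi, j, hj, by rw [heq, map_iterate_map_iterate_sub hf.measurable hνp hj.le]⟩

lemma VSet_subsingleton_of_finite {g : X → X} {x : X} {ι : Type*} [Finite ι] (η : ι → Measure X)
    [∀ q, IsProbabilityMeasure (η q)]
    (hη : ∀ ν ∈ VSet g x, ∃ q, (ν : Measure X) = η q) : (VSet g x).Subsingleton := by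
  obtain ⟨φ, -, hφ⟩ := exists_continuousMap_integral_injOn η
  have hcont := ProbabilityMeasure.continuous_integral_continuousMap φ
  have key : ∀ κ ∈ VSet g x, ∀ ν ∈ VSet g x,
      ¬ ∫ y, φ y ∂(κ : Measure X) < ∫ y, φ y ∂(ν : Measure X) := by
    intro κ hκ ν hν hlt
    obtain ⟨c, ⟨hc1, hc2⟩, hc⟩ := (Ioo_infinite hlt).exists_notMem_finite
      (Set.finite_range fun q => ∫ y, φ y ∂(η q))
    have hcl := mapClusterPt_of_lt_of_lt (tendsto_integral_empPM_succ_sub g x φ)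
      (MapClusterPt.continuousAt_comp hcont.continuousAt hκ)
      (MapClusterPt.continuousAt_comp hcont.continuousAt hν) hc1 hc2
    obtain ⟨ρ, hρ, hρc⟩ := MapClusterPt.exists_of_comp hcont hcl
    obtain ⟨q, hq⟩ := hη ρ hρ
    exact hc ⟨q, by rw [← hρc, hq]⟩
  intro κ hκ ν hν
  obtain ⟨q, hq⟩ := hη κ hκ
  obtain ⟨r, hr⟩ := hη ν hν
  have heq := le_antisymm (not_lt.1 (key ν hν κ hκ)) (not_lt.1 (key κ hκ ν hν))
  exact Subtype.ext (hq.trans ((hφ q r (by rw [← hq, ← hr, heq])).trans hr.symm))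

end MaximalMeasures

/-- Theorem C: if `(X,f)` is uniquely ergodic and there is a prime `p` with
`Q_{f^p}^e(X) ≠ X`, then for every `m ≥ p` there is a non-uniform `A ∈ C(X,GL(m,ℝ))`. -/
theorem exists_nonuniform_cocycle_of_QeSet_ne_univ
    {X : Type*} [MetricSpace X] [CompactSpace X] [MeasurableSpace X] [BorelSpace X]
    (f : X → X) (hf : IsHomeomorph f) (hue : UniquelyErgodic f)
    (p : ℕ) (hp : p.Prime) (hQ : QeSet (f^[p]) ≠ Set.univ)
    (m : ℕ) (hm : p ≤ m) :
    ∃ A : X → Matrix (Fin m) (Fin m) ℝ, ContGL A ∧ ¬ IsUniformCocycle f A := by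
  by_contra! hA
  have hf' := hf.continuous
  have hM := exists_tendstoUniformly_maxBlockSum hf' hue hp.ne_zero hm hA
  refine hQ (Set.eq_univ_of_forall fun x => ?_)
  obtain ⟨κ, hκ⟩ := VSet_nonempty f^[p] x
  let η : Fin p × Fin p → Measure X := fun q => ((κ : Measure X).map f^[q.1]).map f^[p - q.2]
  have hη : ∀ q, IsProbabilityMeasure (η q) := fun q => by
    have := Measure.isProbabilityMeasure_map (μ := (κ : Measure X))
      (hf'.iterate q.1).aemeasurable
    exact Measure.isProbabilityMeasure_map (hf'.iterate _).aemeasurable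
  have hsub : (VSet f^[p] x).Subsingleton := VSet_subsingleton_of_finite η fun ν hν => by
    obtain ⟨i, hi, j, hj, h⟩ := exists_eq_map_map_of_mem_VSet hf' hp.ne_zero hM hκ hν
    exact ⟨(⟨i, hi⟩, ⟨j, hj⟩), h⟩
  exact Set.mem_biUnion (ergodic_of_mem_VSet hf' hp.ne_zero hM hκ)
    (hsub.eq_singleton_of_mem hκ)
end
end
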